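/- arXiv:math-ph/0311024 — 3 statements merged into one kernel-verified Lean document; each statement's English description precedes it below -/
import Mathlib

section
/- Fix an integer d ≥ 1. Let A ⊆ ℝ^d be compact with H_d(A) > 0, and for each N let ω_N ⊆ A be an N-point configuration such that E_d(ω_N)/(N² log N) → H_d(B^d)/H_d(A) as N → ∞, where B^d is the closed unit ball of ℝ^d. Then the normalized counting measures (1/N)∑_{x∈ω_N} δ_x converge weak-star to H_d restricted to A and normalized to a probability measure; equivalently, for every bounded continuous function f : ℝ^d → ℝ, (1/N)∑_{x∈ω_N} f(x) → (1/H_d(A)) ∫_A f dH_d as N → ∞. -/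
open scoped ENNReal NNReal BigOperators Classical
open MeasureTheory Filter Metric Set Topology

/-- The Riesz `s`-energy of a finite configuration `ω`, valued in `[0,∞]`. -/
noncomputable def rieszEnergy {E : Type*} [PseudoEMetricSpace E] (s : ℝ) (ω : Finset E) : ℝ≥0∞ :=
  ∑ x ∈ ω, ∑ y ∈ ω, if x = y then 0 else edist x y ^ (-s)

/-- The `N`-point minimal Riesz `s`-energy over a set `A` (infimum over all `N`-point
subsets of `A`; `∞` if there is none). -/
noncomputable def minRieszEnergy {E : Type*} [PseudoEMetricSpace E] (s : ℝ) (A : Set E)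
    (N : ℕ) : ℝ≥0∞ :=
  ⨅ (ω : Finset E) (_ : ↑ω ⊆ A) (_ : ω.card = N), rieszEnergy s ω

section GaussianSmoothing

lemma gaussian_mul_gaussian {V : Type*} [NormedAddCommGroup V] [InnerProductSpace ℝ V]
    (t : ℝ) (x y u : V) :
    Real.exp (-t * ‖u - x‖ ^ 2) * Real.exp (-t * ‖u - y‖ ^ 2) =
      Real.exp (-(t / 2) * ‖x - y‖ ^ 2) *
        Real.exp (-(2 * t) * ‖u - (1 / 2 : ℝ) • (x + y)‖ ^ 2) := by
  rw [← Real.exp_add, ← Real.exp_add]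
  congr 1
  have h := parallelogram_law_with_norm ℝ (u - x) (u - y)
  have h₁ : (u - x) + (u - y) = (2 : ℝ) • (u - (1 / 2 : ℝ) • (x + y)) := by module
  have h₂ : (u - x) - (u - y) = -(x - y) := by abel
  rw [h₁, h₂, norm_neg, norm_smul, Real.norm_two] at h
  linear_combination (t / 2) * h

variable {V : Type*} [NormedAddCommGroup V] [InnerProductSpace ℝ V] [FiniteDimensional ℝ V]
  [MeasurableSpace V] [BorelSpace V]

lemma integral_gaussian_sub {t : ℝ} (ht : 0 < t) (x : V) :
    ∫ u : V, Real.exp (-t * ‖u - x‖ ^ 2) = (Real.pi / t) ^ (Module.finrank ℝ V / 2 : ℝ) := by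
  rw [integral_sub_right_eq_self (fun u : V => Real.exp (-t * ‖u‖ ^ 2)) x]
  exact GaussianFourier.integral_rexp_neg_mul_sq_norm ht

lemma integrable_gaussian_sub {t : ℝ} (ht : 0 < t) (x : V) :
    Integrable (fun u : V => Real.exp (-t * ‖u - x‖ ^ 2)) := by
  refine not_imp_comm.1 integral_undef ?_
  rw [integral_gaussian_sub ht]
  positivity

lemma integral_gaussian_mul_gaussian {t : ℝ} (ht : 0 < t) (x y : V) :
    ∫ u : V, Real.exp (-t * ‖u - x‖ ^ 2) * Real.exp (-t * ‖u - y‖ ^ 2) =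
      (Real.pi / (2 * t)) ^ (Module.finrank ℝ V / 2 : ℝ) *
        Real.exp (-(t / 2) * ‖x - y‖ ^ 2) := by
  simp_rw [gaussian_mul_gaussian]
  rw [integral_const_mul, integral_gaussian_sub (by positivity), mul_comm]

lemma integrable_gaussian_mul_gaussian {t : ℝ} (ht : 0 < t) (x y : V) :
    Integrable fun u : V => Real.exp (-t * ‖u - x‖ ^ 2) * Real.exp (-t * ‖u - y‖ ^ 2) := by
  simp_rw [gaussian_mul_gaussian]
  exact (integrable_gaussian_sub (by positivity) _).const_mul _

/-- Smoothing by a Gaussian of width `t ^ (-1/2)` loses at most `δ + O(1/t)`. -/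
lemma integral_gaussian_mul_ge {h : V → ℝ} (hc : Continuous h) (hs : HasCompactSupport h)
    {t δ m : ℝ} (ht : 0 < t) (hm : 0 ≤ m) (x : V)
    (hh : ∀ u, h x - δ - m * ‖u - x‖ ^ 2 ≤ h u) :
    (Real.pi / t) ^ (Module.finrank ℝ V / 2 : ℝ) *
        (h x - δ - m * 2 ^ (Module.finrank ℝ V / 2 : ℝ) * (2 / t)) ≤
      ∫ u : V, Real.exp (-t * ‖u - x‖ ^ 2) * h u := by
  have hint : Integrable fun u : V => Real.exp (-t * ‖u - x‖ ^ 2) * h u :=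
    Continuous.integrable_of_hasCompactSupport (by fun_prop) hs.mul_left
  have hlow : Integrable fun u : V => (h x - δ) * Real.exp (-t * ‖u - x‖ ^ 2) -
      m * (2 / t) * Real.exp (-(t / 2) * ‖u - x‖ ^ 2) :=
    ((integrable_gaussian_sub ht x).const_mul _).sub
      ((integrable_gaussian_sub (half_pos ht) x).const_mul _)
  have key := integral_mono hlow hint fun u => by
    have h₁ : Real.exp (-t * ‖u - x‖ ^ 2) * ‖u - x‖ ^ 2 ≤
        2 / t * Real.exp (-(t / 2) * ‖u - x‖ ^ 2) := by
      have h₂ : t / 2 * ‖u - x‖ ^ 2 ≤ Real.exp (t / 2 * ‖u - x‖ ^ 2) := by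
        linarith [Real.add_one_le_exp (t / 2 * ‖u - x‖ ^ 2)]
      have h₃ : Real.exp (-t * ‖u - x‖ ^ 2) * Real.exp (t / 2 * ‖u - x‖ ^ 2) =
          Real.exp (-(t / 2) * ‖u - x‖ ^ 2) := by
        rw [← Real.exp_add]; ring_nf
      rw [← h₃]
      calc Real.exp (-t * ‖u - x‖ ^ 2) * ‖u - x‖ ^ 2
          = 2 / t * (Real.exp (-t * ‖u - x‖ ^ 2) * (t / 2 * ‖u - x‖ ^ 2)) := by field_simp
        _ ≤ _ := by gcongr
    have h₄ := mul_le_mul_of_nonneg_left (hh u) (Real.exp_pos (-t * ‖u - x‖ ^ 2)).le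
    have h₅ := mul_le_mul_of_nonneg_left h₁ hm
    show (h x - δ) * Real.exp (-t * ‖u - x‖ ^ 2) -
      m * (2 / t) * Real.exp (-(t / 2) * ‖u - x‖ ^ 2) ≤ Real.exp (-t * ‖u - x‖ ^ 2) * h u
    linarith
  rw [integral_sub ((integrable_gaussian_sub ht x).const_mul _)
      ((integrable_gaussian_sub (half_pos ht) x).const_mul _), integral_const_mul,
    integral_const_mul, integral_gaussian_sub ht, integral_gaussian_sub (half_pos ht)] at key
  have h₆ : (Real.pi / (t / 2)) ^ (Module.finrank ℝ V / 2 : ℝ) =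
      2 ^ (Module.finrank ℝ V / 2 : ℝ) * (Real.pi / t) ^ (Module.finrank ℝ V / 2 : ℝ) := by
    rw [← Real.mul_rpow (by positivity) (by positivity)]
    congr 1
    field_simp
  rw [h₆] at key
  linarith

/-- A lower bound for Gaussian energies by duality with a test function `h`. -/
lemma sum_gaussian_ge {h : V → ℝ} (hc : Continuous h) (hs : HasCompactSupport h)
    {t δ m : ℝ} (ht : 0 < t) (hm : 0 ≤ m) (hh : ∀ x u, h x - δ - m * ‖u - x‖ ^ 2 ≤ h u)
    (ω : Finset V) :
    (2 * Real.pi / t) ^ (Module.finrank ℝ V / 2 : ℝ) *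
        (2 * ω.card * ∑ x ∈ ω, h x - ω.card ^ 2 * (∫ u, h u ^ 2) -
          2 * ω.card ^ 2 * (δ + m * 2 ^ (Module.finrank ℝ V / 2 : ℝ) * (2 / t))) ≤
      ∑ x ∈ ω, ∑ y ∈ ω, Real.exp (-(t / 2) * ‖x - y‖ ^ 2) := by
  set a : ℝ := Module.finrank ℝ V / 2
  set q : ℝ := (Real.pi / t) ^ a
  have hq : 0 < q := by positivity
  set c : ℝ := ω.card * q
  have hc0 : 0 ≤ c := by positivity
  set F : V → ℝ := fun u => ∑ x ∈ ω, Real.exp (-t * ‖u - x‖ ^ 2)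
  have hFF : ∀ u, F u ^ 2 = ∑ x ∈ ω, ∑ y ∈ ω,
      Real.exp (-t * ‖u - x‖ ^ 2) * Real.exp (-t * ‖u - y‖ ^ 2) := fun u => by
    rw [sq, Finset.sum_mul_sum]
  have hFh : ∀ u, F u * h u = ∑ x ∈ ω, Real.exp (-t * ‖u - x‖ ^ 2) * h u := fun u => by
    rw [Finset.sum_mul]
  have iFF : Integrable fun u => F u ^ 2 := by
    simp_rw [hFF]
    exact integrable_finsetSum _ fun x _ => integrable_finsetSum _ fun y _ =>
      integrable_gaussian_mul_gaussian ht x y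
  have ixh : ∀ x, Integrable fun u : V => Real.exp (-t * ‖u - x‖ ^ 2) * h u := fun x =>
    Continuous.integrable_of_hasCompactSupport (by fun_prop) hs.mul_left
  have iFh : Integrable fun u => F u * h u := by
    simp_rw [hFh]
    exact integrable_finsetSum _ fun x _ => ixh x
  have ihh : Integrable fun u => h u ^ 2 := by
    simp_rw [sq]
    exact Continuous.integrable_of_hasCompactSupport (by fun_prop) hs.mul_left
  have eFF : ∫ u, F u ^ 2 = (Real.pi / (2 * t)) ^ a *
      ∑ x ∈ ω, ∑ y ∈ ω, Real.exp (-(t / 2) * ‖x - y‖ ^ 2) := by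
    simp_rw [hFF]
    rw [integral_finsetSum _ fun x _ => integrable_finsetSum _ fun y _ =>
      integrable_gaussian_mul_gaussian ht x y, Finset.mul_sum]
    refine Finset.sum_congr rfl fun x _ => ?_
    rw [integral_finsetSum _ fun y _ => integrable_gaussian_mul_gaussian ht x y, Finset.mul_sum]
    exact Finset.sum_congr rfl fun y _ => integral_gaussian_mul_gaussian ht x y
  have eFh : q * (∑ x ∈ ω, h x - ω.card * (δ + m * 2 ^ a * (2 / t))) ≤ ∫ u, F u * h u := by
    simp_rw [hFh]
    rw [integral_finsetSum _ fun x _ => ixh x, ← nsmul_eq_mul, ← Finset.sum_const,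
      ← Finset.sum_sub_distrib, Finset.mul_sum]
    refine Finset.sum_le_sum fun x _ => ?_
    rw [← sub_sub]
    exact integral_gaussian_mul_ge hc hs ht hm x (hh x)
  have hpos : 0 ≤ ∫ u, (F u - c * h u) ^ 2 := integral_nonneg fun u => sq_nonneg _
  have hexp : ∫ u, (F u - c * h u) ^ 2 =
      (∫ u, F u ^ 2) - 2 * c * (∫ u, F u * h u) + c ^ 2 * ∫ u, h u ^ 2 := by
    rw [← integral_const_mul, ← integral_const_mul, ← integral_sub iFF (iFh.const_mul _),
      ← integral_add (by exact iFF.sub (iFh.const_mul _)) (ihh.const_mul _)]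
    congr 1 with u
    ring
  rw [hexp, eFF] at hpos
  have h₁ := mul_le_mul_of_nonneg_left eFh (mul_nonneg zero_le_two hc0)
  have hr : (2 * Real.pi / t) ^ a * (Real.pi / (2 * t)) ^ a = q ^ 2 := by
    rw [← Real.mul_rpow (by positivity) (by positivity), sq,
      ← Real.mul_rpow (by positivity) (by positivity)]
    congr 1
    field_simp
  have hp : 0 < (Real.pi / (2 * t)) ^ a := by positivity
  refine le_of_mul_le_mul_left ?_ hp
  rw [← mul_assoc, mul_comm ((Real.pi / (2 * t)) ^ a), hr]
  linarith

end GaussianSmoothing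

lemma intervalIntegral_rpow_mul_exp_le {a r T S : ℝ} (ha : 0 < a) (hr : 0 < r) (hT : 0 < T)
    (hTS : T ≤ S) :
    ∫ t in T..S, t ^ (a - 1) * Real.exp (-(t / 2) * r ^ 2) ≤
      Real.Gamma a * 2 ^ a * r ^ (-(2 * a)) := by
  have h₁ := Real.integral_rpow_mul_exp_neg_mul_Ioi ha (r := r ^ 2 / 2) (by positivity)
  have h₂ : (1 / (r ^ 2 / 2)) ^ a * Real.Gamma a = Real.Gamma a * 2 ^ a * r ^ (-(2 * a)) := by
    rw [one_div_div, Real.div_rpow zero_le_two (by positivity), Real.rpow_neg hr.le,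
      Real.rpow_mul hr.le, Real.rpow_two]
    ring
  have h₃ : ∀ t : ℝ, -(t / 2) * r ^ 2 = -(r ^ 2 / 2 * t) := fun t => by ring
  simp_rw [h₃]
  rw [← h₂, ← h₁, intervalIntegral.integral_of_le hTS]
  refine setIntegral_mono_set ?_ ?_ ?_
  · refine not_imp_comm.1 integral_undef ?_
    rw [h₁]
    have := Real.Gamma_pos_of_pos ha
    positivity
  · filter_upwards [ae_restrict_mem measurableSet_Ioi] with t ht
    have : 0 < t := ht
    show 0 ≤ _
    positivity
  · exact Eventually.of_forall fun t ht => hT.trans ht.1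

/-- The real-valued form of the Riesz energy. -/
lemma toReal_rieszEnergy {E : Type*} [MetricSpace E] (s : ℝ) (ω : Finset E) :
    (rieszEnergy s ω).toReal = ∑ x ∈ ω, ∑ y ∈ ω, if x = y then 0 else dist x y ^ (-s) := by
  have hfin : ∀ x y : E, (if x = y then 0 else edist x y ^ (-s)) ≠ ∞ := fun x y => by
    split_ifs with h
    · exact ENNReal.zero_ne_top
    · exact ENNReal.rpow_ne_top_of_ne_zero (by simpa using h) (edist_ne_top x y)
  rw [rieszEnergy, ENNReal.toReal_sum fun x _ => ENNReal.sum_ne_top.2 fun y _ => hfin x y]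
  refine Finset.sum_congr rfl fun x _ => ?_
  rw [ENNReal.toReal_sum fun y _ => hfin x y]
  refine Finset.sum_congr rfl fun y _ => ?_
  split_ifs with h
  · rfl
  · rw [← ENNReal.toReal_rpow, ← dist_edist]

/-- Integrating a lower bound for Gaussian energies over the scales `[T, S]` gives a lower bound
for the Riesz energy. -/
lemma rieszEnergy_ge_of_gaussian {V : Type*} [NormedAddCommGroup V] {a T S L : ℝ} (ha : 0 < a)
    (hT : 0 < T) (hTS : T ≤ S) (ω : Finset V)
    (hL : ∀ t, T ≤ t → (2 * Real.pi / t) ^ a * L ≤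
      ∑ x ∈ ω, ∑ y ∈ ω, Real.exp (-(t / 2) * ‖x - y‖ ^ 2)) :
    (2 * Real.pi) ^ a * L * Real.log (S / T) - ω.card * (S ^ a / a) ≤
      Real.Gamma a * 2 ^ a * (rieszEnergy (2 * a) ω).toReal := by
  have hS : 0 < S := hT.trans_le hTS
  set G : V → V → ℝ → ℝ := fun x y t =>
    if x = y then 0 else t ^ (a - 1) * Real.exp (-(t / 2) * ‖x - y‖ ^ 2)
  have hne : ∀ t ∈ uIcc T S, t ≠ 0 := fun t ht => by
    rw [uIcc_of_le hTS] at ht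
    exact (hT.trans_le ht.1).ne'
  have hG : ∀ x y, IntervalIntegrable (G x y) volume T S := fun x y => by
    refine ContinuousOn.intervalIntegrable ?_
    by_cases h : x = y
    · simp only [G, if_pos h]
      exact continuousOn_const
    · simp only [G, if_neg h]
      exact (continuousOn_id.rpow_const fun t ht => Or.inl (hne t ht)).mul (by fun_prop)
  have hi₁ : IntervalIntegrable (fun t : ℝ => t⁻¹) volume T S :=
    (continuousOn_id.inv₀ hne).intervalIntegrable
  have hi₂ : IntervalIntegrable (fun t : ℝ => t ^ (a - 1)) volume T S :=
    (continuousOn_id.rpow_const fun t ht => Or.inl (hne t ht)).intervalIntegrable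
  have hsum : IntervalIntegrable (fun t => ∑ x ∈ ω, ∑ y ∈ ω, G x y t) volume T S := by
    simpa only [Finset.sum_fn] using IntervalIntegrable.sum ω fun x _ =>
      IntervalIntegrable.sum ω fun y _ => hG x y
  have key : ∫ t in T..S, ((2 * Real.pi) ^ a * L * t⁻¹ - ω.card * t ^ (a - 1)) ≤
      ∫ t in T..S, ∑ x ∈ ω, ∑ y ∈ ω, G x y t := by
    refine intervalIntegral.integral_mono_on hTS
      ((hi₁.const_mul _).sub (hi₂.const_mul _)) hsum fun t ht => ?_
    have ht0 : 0 < t := hT.trans_le ht.1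
    have hdiag : ∑ x ∈ ω, ∑ y ∈ ω, G x y t = t ^ (a - 1) *
        (∑ x ∈ ω, ∑ y ∈ ω, Real.exp (-(t / 2) * ‖x - y‖ ^ 2) - ω.card) := by
      have h₁ : (ω.card : ℝ) = ∑ x ∈ ω, ∑ y ∈ ω, if x = y then (1 : ℝ) else 0 := by
        simp
      rw [h₁, ← Finset.sum_sub_distrib, Finset.mul_sum]
      refine Finset.sum_congr rfl fun x _ => ?_
      rw [← Finset.sum_sub_distrib, Finset.mul_sum]
      refine Finset.sum_congr rfl fun y _ => ?_
      by_cases h : x = y <;> simp [G, h]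
    have hpow : t⁻¹ = t ^ (a - 1) * (t ^ a)⁻¹ := by
      rw [← Real.rpow_neg ht0.le, ← Real.rpow_add ht0, ← Real.rpow_neg_one]
      ring_nf
    have h₂ := mul_le_mul_of_nonneg_left (hL t ht.1) (Real.rpow_nonneg ht0.le (a - 1))
    rw [Real.div_rpow (by positivity) ht0.le] at h₂
    rw [hdiag, hpow]
    calc (2 * Real.pi) ^ a * L * (t ^ (a - 1) * (t ^ a)⁻¹) - ω.card * t ^ (a - 1)
        = t ^ (a - 1) * ((2 * Real.pi) ^ a / t ^ a * L) - ω.card * t ^ (a - 1) := by ring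
      _ ≤ _ := by linarith
  rw [intervalIntegral.integral_sub (hi₁.const_mul _) (hi₂.const_mul _),
    intervalIntegral.integral_const_mul, intervalIntegral.integral_const_mul,
    integral_inv_of_pos hT hS, integral_rpow (Or.inl (by linarith)), sub_add_cancel,
    intervalIntegral.integral_finsetSum fun x _ => by
      simpa only [Finset.sum_fn] using IntervalIntegrable.sum ω fun y _ => hG x y] at key
  have hle : ∑ x ∈ ω, ∫ t in T..S, ∑ y ∈ ω, G x y t ≤
      Real.Gamma a * 2 ^ a * (rieszEnergy (2 * a) ω).toReal := by
    rw [toReal_rieszEnergy, Finset.mul_sum]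
    refine Finset.sum_le_sum fun x _ => ?_
    rw [intervalIntegral.integral_finsetSum fun y _ => hG x y, Finset.mul_sum]
    refine Finset.sum_le_sum fun y _ => ?_
    by_cases h : x = y
    · simp [G, h]
    · simp only [G, if_neg h, dist_eq_norm]
      exact intervalIntegral_rpow_mul_exp_le ha (norm_pos_iff.2 (sub_ne_zero.2 h)) hT hTS
  have hdrop : (ω.card : ℝ) * ((S ^ a - T ^ a) / a) ≤ ω.card * (S ^ a / a) := by
    gcongr
    have : 0 ≤ T ^ a := by positivity
    linarith
  linarith

lemma exists_le_add_mul_norm_sq {V : Type*} [NormedAddCommGroup V] {h : V → ℝ}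
    (hc : Continuous h) (hs : HasCompactSupport h) {δ : ℝ} (hδ : 0 < δ) :
    ∃ m, 0 ≤ m ∧ ∀ x u, h x - δ - m * ‖u - x‖ ^ 2 ≤ h u := by
  obtain ⟨B, hB⟩ := hs.exists_bound_of_continuous hc
  obtain ⟨R, hR, hRu⟩ := Metric.uniformContinuous_iff.1 (hs.uniformContinuous_of_continuous hc) δ hδ
  have hB0 : 0 ≤ B := (norm_nonneg _).trans (hB 0)
  refine ⟨2 * B / R ^ 2, by positivity, fun x u => ?_⟩
  rcases lt_or_ge (dist u x) R with hd | hd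
  · have h₁ := (abs_lt.1 (hRu hd)).1
    have h₂ : 0 ≤ 2 * B / R ^ 2 * ‖u - x‖ ^ 2 := by positivity
    linarith
  · have h₁ : 2 * B ≤ 2 * B / R ^ 2 * ‖u - x‖ ^ 2 := by
      rw [div_mul_eq_mul_div, le_div_iff₀ (by positivity), ← dist_eq_norm]
      gcongr
    have h₂ := (abs_le.1 (hB x)).2
    have h₃ := (abs_le.1 (hB u)).1
    linarith

/-- A quantitative lower bound for the `d`-energy in dimension `d`: up to lower order terms, the
normalized energy of `ω` dominates `2 ∫ h dν - ∫ h ^ 2`, where `ν` is the normalized counting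
measure of `ω`. -/
lemma exists_forall_rieszEnergy_ge {V : Type*} [NormedAddCommGroup V] [InnerProductSpace ℝ V]
    [FiniteDimensional ℝ V] [MeasurableSpace V] [BorelSpace V] [Nontrivial V] {h : V → ℝ}
    (hc : Continuous h) (hs : HasCompactSupport h) {δ : ℝ} (hδ : 0 < δ) :
    ∃ (C : ℝ) (N₀ : ℕ), ∀ ω : Finset V, N₀ ≤ ω.card →
      (volume (closedBall (0 : V) 1)).toReal *
          (2 * ((1 / (ω.card : ℝ)) * ∑ x ∈ ω, h x) - (∫ u, h u ^ 2) - δ) * Real.log ω.card ≤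
        (rieszEnergy (Module.finrank ℝ V : ℝ) ω).toReal / (ω.card : ℝ) ^ 2 + C := by
  obtain ⟨m, hm, hmh⟩ := exists_le_add_mul_norm_sq hc hs (δ := δ / 4) (by positivity)
  obtain ⟨B, hB⟩ := hs.exists_bound_of_continuous hc
  have hB0 : 0 ≤ B := (norm_nonneg _).trans (hB 0)
  set a : ℝ := Module.finrank ℝ V / 2 with ha_def
  have ha : 0 < a := by
    have : 0 < Module.finrank ℝ V := Module.finrank_pos
    positivity
  have hvol : (volume (closedBall (0 : V) 1)).toReal = Real.pi ^ a / (a * Real.Gamma a) := by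
    rw [InnerProductSpace.volume_closedBall, ← Real.Gamma_add_one ha.ne', Real.sqrt_eq_rpow,
      ← Real.rpow_mul_natCast Real.pi_pos.le]
    have h₁ : (1 / 2 : ℝ) * Module.finrank ℝ V = a := by rw [ha_def]; ring
    have h₂ : 0 ≤ Real.pi ^ a / Real.Gamma (a + 1) := by
      have := Real.Gamma_pos_of_pos (show 0 < a + 1 by linarith)
      positivity
    rw [h₁, ENNReal.ofReal_one, one_pow, one_mul, ENNReal.toReal_ofReal h₂]
  set T : ℝ := max 1 (8 * (m * 2 ^ a) / δ)
  have hT1 : 1 ≤ T := le_max_left _ _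
  have hT0 : 0 < T := by linarith
  have hΓ := Real.Gamma_pos_of_pos ha
  rw [hvol]
  set κ : ℝ := Real.pi ^ a / (a * Real.Gamma a) with hκ_def
  have hκ : 0 < κ := by positivity
  refine ⟨κ * (2 * B) * (a * Real.log T) + 1 / (a * (Real.Gamma a * 2 ^ a)),
    max 1 ⌈T ^ a⌉₊, fun ω hω => ?_⟩
  have hN1 : (1 : ℝ) ≤ ω.card := by exact_mod_cast (le_max_left _ _).trans hω
  have hNT : T ^ a ≤ ω.card := (Nat.le_ceil _).trans (by exact_mod_cast (le_max_right _ _).trans hω)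
  set N : ℝ := (ω.card : ℝ) with hN_def
  have hN0 : 0 < N := by linarith
  set L : ℝ := 2 * ((1 / N) * ∑ x ∈ ω, h x) - (∫ u, h u ^ 2) - δ with hL_def
  have hS : (N ^ (1 / a)) ^ a = N := by
    rw [← Real.rpow_mul hN0.le, one_div_mul_cancel ha.ne', Real.rpow_one]
  have hTS : T ≤ N ^ (1 / a) := by
    rw [← Real.rpow_le_rpow_iff hT0.le (by positivity) ha, hS]
    exact hNT
  have hgauss : ∀ t, T ≤ t → (2 * Real.pi / t) ^ a * (N ^ 2 * L) ≤
      ∑ x ∈ ω, ∑ y ∈ ω, Real.exp (-(t / 2) * ‖x - y‖ ^ 2) := fun t ht => by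
    have ht0 : 0 < t := hT0.trans_le ht
    refine le_trans ?_ (sum_gaussian_ge hc hs ht0 hm hmh ω)
    have h₁ : m * 2 ^ a * (2 / t) ≤ δ / 4 := by
      have h₂ : 8 * (m * 2 ^ a) / δ ≤ t := (le_max_right _ _).trans ht
      rw [div_le_iff₀ hδ] at h₂
      rw [mul_div_assoc', div_le_iff₀ ht0]
      linarith
    gcongr
    have h₃ : N ^ 2 * L = 2 * N * ∑ x ∈ ω, h x - N ^ 2 * (∫ u, h u ^ 2) - N ^ 2 * δ := by
      rw [hL_def]
      field_simp
    have h₄ : 2 * N ^ 2 * (δ / 4 + m * 2 ^ a * (2 / t)) ≤ 2 * N ^ 2 * (δ / 4 + δ / 4) := by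
      gcongr
    linarith
  have key := rieszEnergy_ge_of_gaussian ha hT0 hTS ω hgauss
  rw [Real.log_div (by positivity) hT0.ne', Real.log_rpow hN0, hS,
    show 2 * a = Module.finrank ℝ V by rw [ha_def]; ring,
    Real.mul_rpow zero_le_two Real.pi_pos.le, ← hN_def] at key
  have hLB : L ≤ 2 * B := by
    have h₁ : ∑ x ∈ ω, h x ≤ N * B := by
      rw [hN_def, ← nsmul_eq_mul]
      exact Finset.sum_le_card_nsmul _ _ _ fun x _ => (le_abs_self _).trans (hB x)
    have h₂ : (1 / N) * ∑ x ∈ ω, h x ≤ B := by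
      rw [one_div, inv_mul_le_iff₀ hN0]
      exact h₁
    have h₃ : 0 ≤ ∫ u, h u ^ 2 := integral_nonneg fun u => sq_nonneg _
    linarith
  have hlast : κ * L * (a * Real.log T) ≤ κ * (2 * B) * (a * Real.log T) := by
    have := Real.log_nonneg hT1
    gcongr
  have h2a : (0 : ℝ) < 2 ^ a := by positivity
  have hdiv : κ * L * (Real.log N - a * Real.log T) - 1 / (a * (Real.Gamma a * 2 ^ a)) ≤
      (rieszEnergy (Module.finrank ℝ V : ℝ) ω).toReal / N ^ 2 := by
    rw [le_div_iff₀ (by positivity)]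
    refine le_of_mul_le_mul_left (le_trans (le_of_eq ?_) key) (mul_pos hΓ h2a)
    rw [hκ_def]
    field_simp
  linarith

/-- A bounded continuous function on a compact set `A` extends to a compactly supported function
with almost no additional `L²` mass. -/
lemma exists_extension_integral_sq_le {X : Type*} [TopologicalSpace X] [LocallyCompactSpace X]
    [T2Space X] [MeasurableSpace X] [BorelSpace X] {μ : Measure X} [IsFiniteMeasureOnCompacts μ]
    [μ.OuterRegular] {A : Set X} (hA : IsCompact A) {k : X → ℝ} (hk : Continuous k) {K : ℝ}
    (hK : ∀ x, |k x| ≤ K) {η : ℝ} (hη : 0 < η) :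
    ∃ h : X → ℝ, Continuous h ∧ HasCompactSupport h ∧ EqOn h k A ∧
      ∫ x, h x ^ 2 ∂μ ≤ (∫ x in A, k x ^ 2 ∂μ) + K ^ 2 * η := by
  obtain ⟨U, hAU, hUo, hU⟩ := A.exists_isOpen_lt_add (μ := μ) hA.measure_lt_top.ne
    (ENNReal.ofReal_pos.2 hη).ne'
  obtain ⟨φ, hφ1, hφ0, hφs, hφ⟩ := exists_continuous_one_zero_of_isCompact hA hUo.isClosed_compl
    (disjoint_compl_right_iff_subset.2 hAU)
  have hUtop : μ U ≠ ∞ := (hU.trans (ENNReal.add_lt_top.2 ⟨hA.measure_lt_top,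
    ENNReal.ofReal_lt_top⟩)).ne
  have hkint : IntegrableOn (fun x => k x ^ 2) U μ :=
    Measure.integrableOn_of_bounded (M := K ^ 2) hUtop (by fun_prop)
      (Eventually.of_forall fun x => by
        rw [Real.norm_of_nonneg (sq_nonneg _), ← sq_abs]
        have := hK x
        gcongr)
  have hdiff : μ.real (U \ A) ≤ η := by
    refine ENNReal.toReal_le_of_le_ofReal hη.le ?_
    rw [measure_sdiff hAU hA.measurableSet.nullMeasurableSet hA.measure_lt_top.ne]
    exact tsub_le_iff_left.2 hU.le
  refine ⟨fun x => φ x * k x, by fun_prop, hφs.mul_right, fun x hx => by simp [hφ1 hx], ?_⟩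
  have hsupp : ∫ x, (φ x * k x) ^ 2 ∂μ = ∫ x in U, (φ x * k x) ^ 2 ∂μ := by
    refine (setIntegral_eq_integral_of_forall_compl_eq_zero fun x hx => ?_).symm
    simp [hφ0 hx]
  have hle : ∀ x, (φ x * k x) ^ 2 ≤ k x ^ 2 := fun x => by
    rw [mul_pow]
    exact mul_le_of_le_one_left (sq_nonneg _) (pow_le_one₀ (hφ x).1 (hφ x).2)
  have hmono : ∫ x in U, (φ x * k x) ^ 2 ∂μ ≤ ∫ x in U, k x ^ 2 ∂μ :=
    integral_mono_of_nonneg (Eventually.of_forall fun x => sq_nonneg _) hkint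
      (Eventually.of_forall hle)
  have hsplit : ∫ x in U, k x ^ 2 ∂μ = (∫ x in A, k x ^ 2 ∂μ) + ∫ x in U \ A, k x ^ 2 ∂μ := by
    rw [setIntegral_sdiff hA.measurableSet hkint hAU]
    ring
  have hrest : ∫ x in U \ A, k x ^ 2 ∂μ ≤ K ^ 2 * η := by
    have h₁ := norm_setIntegral_le_of_norm_le_const (μ := μ) (s := U \ A)
      (f := fun x => k x ^ 2) (C := K ^ 2) ((measure_mono sdiff_subset).trans_lt hUtop.lt_top)
      fun x _ => by
        rw [Real.norm_of_nonneg (sq_nonneg _), ← sq_abs]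
        have := hK x
        gcongr
    exact (le_abs_self _).trans (h₁.trans (by gcongr))
  linarith

/-- If the discrete averages over `ω N ⊆ A` satisfy the energy duality bound with
asymptotically optimal energies `e N / (N ^ 2 log N) → H / μ(A)`, then they are asymptotically
at most the mean over `A`. -/
lemma eventually_average_le {X : Type*} [TopologicalSpace X] [LocallyCompactSpace X]
    [T2Space X] [MeasurableSpace X] [BorelSpace X] {μ : Measure X} [IsFiniteMeasureOnCompacts μ]
    [μ.OuterRegular] {A : Set X} (hA : IsCompact A) (hα : 0 < (μ A).toReal) {H : ℝ} (hH : 0 < H)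
    {ω : ℕ → Finset X} {e : Finset X → ℝ} (hsub : ∀ N, ↑(ω N) ⊆ A) (hcard : ∀ N, (ω N).card = N)
    (he : Tendsto (fun N : ℕ => e (ω N) / ((N : ℝ) ^ 2 * Real.log N)) atTop
      (𝓝 (H / (μ A).toReal)))
    {g : X → ℝ} (hg : Continuous g) {M : ℝ} (hM : ∀ x, |g x| ≤ M) {ε : ℝ} (hε : 0 < ε)
    (hdual : ∀ h : X → ℝ, Continuous h → HasCompactSupport h → ∀ δ : ℝ, 0 < δ →
      ∃ (C : ℝ) (N₀ : ℕ), ∀ σ : Finset X, N₀ ≤ σ.card →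
        H * (2 * ((1 / (σ.card : ℝ)) * ∑ x ∈ σ, h x) - (∫ u, h u ^ 2 ∂μ) - δ) *
          Real.log σ.card ≤ e σ / (σ.card : ℝ) ^ 2 + C) :
    ∀ᶠ N : ℕ in atTop, (1 / (N : ℝ)) * ∑ x ∈ ω N, g x ≤ (∫ x in A, g x ∂μ) / (μ A).toReal + ε := by
  set α : ℝ := (μ A).toReal with hα_def
  have hfin : μ A ≠ ∞ := hA.measure_lt_top.ne
  obtain ⟨s, hs, hsM⟩ : ∃ s : ℝ, 0 < s ∧ s * (M ^ 2 * α) ≤ ε := by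
    refine ⟨ε / (M ^ 2 * α + 1), by positivity, ?_⟩
    rw [div_mul_eq_mul_div, div_le_iff₀ (by positivity)]
    nlinarith
  set K : ℝ := 1 / α + s * |M|
  have hK : 0 < K := by positivity
  set τ : ℝ := s * ε / 4
  have hτ : 0 < τ := by positivity
  obtain ⟨h, hc, hsupp, hhA, hint⟩ := exists_extension_integral_sq_le (μ := μ) hA
    (k := fun x => 1 / α + s * g x) (by fun_prop) (K := K) (fun x => by
      refine (abs_add_le _ _).trans ?_
      rw [abs_of_pos (by positivity : 0 < 1 / α), abs_mul, abs_of_pos hs]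
      exact add_le_add_right (mul_le_mul_of_nonneg_left ((hM x).trans (le_abs_self M)) hs.le) _)
    (η := τ / K ^ 2) (by positivity)
  rw [mul_div_cancel₀ _ (by positivity)] at hint
  obtain ⟨C, N₀, hC⟩ := hdual h hc hsupp τ hτ
  have hgA : IntegrableOn g A μ := hg.continuousOn.integrableOn_compact hA
  have hg2A : IntegrableOn (fun x => g x ^ 2) A μ := (hg.pow 2).continuousOn.integrableOn_compact hA
  have hconst : ∫ _ in A, (1 / α) ^ 2 ∂μ = 1 / α := by
    rw [setIntegral_const, smul_eq_mul, measureReal_def, ← hα_def]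
    field_simp
  have hsq : ∫ x in A, (1 / α + s * g x) ^ 2 ∂μ =
      1 / α + 2 * s * ((∫ x in A, g x ∂μ) / α) + s ^ 2 * ∫ x in A, g x ^ 2 ∂μ := by
    have h₁ : ∀ x, (1 / α + s * g x) ^ 2 =
        (1 / α) ^ 2 + 2 * s / α * g x + s ^ 2 * g x ^ 2 := fun x => by ring
    have h₀ : IntegrableOn (fun _ => (1 / α) ^ 2) A μ := integrableOn_const hfin
    simp_rw [h₁]
    rw [integral_add (by exact h₀.add (hgA.const_mul _)) (hg2A.const_mul _),
      integral_add h₀ (hgA.const_mul _), integral_const_mul, integral_const_mul, hconst]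
    ring
  have hg2 : ∫ x in A, g x ^ 2 ∂μ ≤ M ^ 2 * α := by
    have h₁ := norm_setIntegral_le_of_norm_le_const (μ := μ) (s := A)
      (f := fun x => g x ^ 2) (C := M ^ 2) hfin.lt_top fun x _ => by
        rw [Real.norm_of_nonneg (sq_nonneg _), ← sq_abs]
        have := hM x
        gcongr
    exact (le_abs_self _).trans h₁
  have hlog : Tendsto (fun N : ℕ => C / Real.log N) atTop (𝓝 0) :=
    (Real.tendsto_log_atTop.comp tendsto_natCast_atTop_atTop).const_div_atTop C
  have hHτ : 0 < H * τ := by positivity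
  filter_upwards [he.eventually_lt_const (lt_add_of_pos_right _ hHτ),
    hlog.eventually_lt_const hHτ, eventually_ge_atTop N₀, eventually_ge_atTop 2]
    with N h₁ h₂ h₃ h₄
  have h₅ := hC (ω N) (by rwa [hcard])
  rw [hcard] at h₅
  have hN : (0 : ℝ) < N := by positivity
  have hlogN : 0 < Real.log N := Real.log_pos (by exact_mod_cast h₄)
  have havg : (1 / (N : ℝ)) * ∑ x ∈ ω N, h x = 1 / α + s * ((1 / (N : ℝ)) * ∑ x ∈ ω N, g x) := by
    rw [Finset.sum_congr rfl fun x hx => hhA (hsub N hx), Finset.sum_add_distrib,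
      Finset.sum_const, hcard, nsmul_eq_mul, ← Finset.mul_sum]
    field_simp
  rw [havg, ← le_div_iff₀ hlogN, add_div, div_div] at h₅
  have h₆ : H * (2 * (1 / α + s * ((1 / (N : ℝ)) * ∑ x ∈ ω N, g x)) - (∫ u, h u ^ 2 ∂μ) - τ) ≤
      H * (1 / α + 2 * τ) := by
    have : H / α = H * (1 / α) := by ring
    linarith
  have h₇ := le_of_mul_le_mul_left h₆ hH
  have h₈ : s ^ 2 * ∫ x in A, g x ^ 2 ∂μ ≤ s * ε := by
    calc s ^ 2 * ∫ x in A, g x ^ 2 ∂μ ≤ s ^ 2 * (M ^ 2 * α) := by gcongr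
      _ = s * (s * (M ^ 2 * α)) := by ring
      _ ≤ s * ε := by gcongr
  have h₉ : 4 * τ = s * ε := by ring
  refine le_of_mul_le_mul_left (a := 2 * s) ?_ (by positivity)
  linarith

/-- configurations on a compact `A ⊆ ℝ^d` of positive measure whose `d`-energy
satisfies `E_d(ω_N)/(N² log N) → H_d(B^d)/H_d(A)` are asymptotically uniformly distributed
with respect to `H_d` on `A`. -/
theorem asympt_minimizing_equidistributed_crit (d : ℕ) (hd : 1 ≤ d)
    (A : Set (EuclideanSpace ℝ (Fin d))) (hA : IsCompact A) (hA0 : 0 < volume A)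
    (ω : ℕ → Finset (EuclideanSpace ℝ (Fin d)))
    (hsub : ∀ N, ↑(ω N) ⊆ A) (hcard : ∀ N, (ω N).card = N)
    (hω : Tendsto
      (fun N : ℕ => rieszEnergy (d : ℝ) (ω N) / ENNReal.ofReal ((N : ℝ) ^ 2 * Real.log N))
      atTop
      (𝓝 (volume (Metric.closedBall (0 : EuclideanSpace ℝ (Fin d)) 1) / volume A))) :
    ∀ f : EuclideanSpace ℝ (Fin d) → ℝ, Continuous f → (∃ M : ℝ, ∀ x, |f x| ≤ M) →
      Tendsto (fun N : ℕ => (1 / (N : ℝ)) * ∑ x ∈ ω N, f x) atTop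
        (𝓝 ((∫ x in A, f x) / (volume A).toReal)) := by
  have : Nonempty (Fin d) := ⟨⟨0, hd⟩⟩
  set H : ℝ := (volume (closedBall (0 : EuclideanSpace ℝ (Fin d)) 1)).toReal with hH_def
  have hH : 0 < H := ENNReal.toReal_pos (measure_closedBall_pos _ _ one_pos).ne'
    measure_closedBall_lt_top.ne
  have hα : 0 < (volume A).toReal := ENNReal.toReal_pos hA0.ne' hA.measure_lt_top.ne
  have hE : Tendsto (fun N : ℕ => (rieszEnergy (d : ℝ) (ω N)).toReal / ((N : ℝ) ^ 2 * Real.log N))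
      atTop (𝓝 (H / (volume A).toReal)) := by
    rw [hH_def, ← ENNReal.toReal_div]
    refine ((ENNReal.tendsto_toReal
      (ENNReal.div_ne_top measure_closedBall_lt_top.ne hA0.ne')).comp hω).congr fun N => ?_
    rw [Function.comp_apply, ENNReal.toReal_div, ENNReal.toReal_ofReal]
    have := Real.log_natCast_nonneg N
    positivity
  intro f hf ⟨M, hM⟩
  have upper : ∀ g : EuclideanSpace ℝ (Fin d) → ℝ, Continuous g → (∀ x, |g x| ≤ M) → ∀ ε > 0,
      ∀ᶠ N : ℕ in atTop, (1 / (N : ℝ)) * ∑ x ∈ ω N, g x ≤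
        (∫ x in A, g x) / (volume A).toReal + ε := fun g hg hgM ε hε => by
    refine eventually_average_le (e := fun σ => (rieszEnergy (d : ℝ) σ).toReal) hA hα hH hsub hcard
      hE hg hgM hε fun h hc hs δ hδ => ?_
    simpa using exists_forall_rieszEnergy_ge hc hs hδ
  refine tendsto_order.2 ⟨fun b hb => ?_, fun b hb => ?_⟩
  · filter_upwards [upper (fun x => -f x) hf.neg (fun x => by simpa using hM x) _
      (half_pos (sub_pos.2 hb))] with N hN
    rw [Finset.sum_neg_distrib, integral_neg, neg_div, mul_neg] at hN
    linarith
  · filter_upwards [upper f hf hM _ (half_pos (sub_pos.2 hb))] with N hN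
    linarith
end

section
/- Fix an integer d ≥ 1 and a real s > d. Let A ⊆ ℝ^d be compact with H_d(A) > 0. Then there exists a constant C > 0 (depending on A, s, d) such that for every N ≥ 2 and every N-point configuration ω*_N = {x_1,…,x_N} ⊆ A attaining the minimal s-energy (i.e., E_s(ω*_N) = ℰ_s(A,N)), one has min_{i≠j} |x_i − x_j| ≥ C · N^{−1/d}. -/
open scoped ENNReal NNReal BigOperators Classical
open MeasureTheory Filter Metric Set Topology

/-- Adding a point `x` to a configuration adds twice the potential of the configuration at `x`. -/
theorem rieszEnergy_insert {E : Type*} [PseudoEMetricSpace E] (s : ℝ) {T : Finset E} {x : E}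
    (hx : x ∉ T) :
    rieszEnergy s (insert x T) = rieszEnergy s T + 2 * ∑ y ∈ T, edist x y ^ (-s) := by
  have h1 : ∑ y ∈ T, (if x = y then 0 else edist x y ^ (-s)) = ∑ y ∈ T, edist x y ^ (-s) :=
    Finset.sum_congr rfl fun y hy => if_neg fun h : x = y => hx (h ▸ hy)
  have h2 : ∑ y ∈ T, (if y = x then 0 else edist y x ^ (-s)) = ∑ y ∈ T, edist x y ^ (-s) :=
    Finset.sum_congr rfl fun y hy => by
      rw [if_neg fun h : y = x => hx (h ▸ hy), edist_comm]
  simp only [rieszEnergy, Finset.sum_insert hx, Finset.sum_add_distrib, h1, h2, if_true]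
  ring

theorem rieszEnergy_ne_top {E : Type*} [EMetricSpace E] {s : ℝ} (hs : 0 < s) (T : Finset E) :
    rieszEnergy s T ≠ ⊤ := by
  refine ENNReal.sum_ne_top.2 fun x _ => ENNReal.sum_ne_top.2 fun y _ => ?_
  split_ifs with h
  · simp
  · simp only [ne_eq, ENNReal.rpow_eq_top_iff, not_or, not_and]
    exact ⟨fun h0 => absurd (edist_eq_zero.1 h0) h, fun _ => by linarith⟩

/-- In an optimal configuration, every point minimizes over `A` the potential of the others. -/
theorem potential_le_of_rieszEnergy_eq_min {E : Type*} [EMetricSpace E] {s : ℝ} (hs : 0 < s)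
    {A : Set E} {ω : Finset E} (hωA : ↑ω ⊆ A)
    (hω : rieszEnergy s ω = minRieszEnergy s A ω.card) {x z : E} (hx : x ∈ ω) (hz : z ∈ A) :
    ∑ y ∈ ω.erase x, edist x y ^ (-s) ≤ ∑ y ∈ ω.erase x, edist z y ^ (-s) := by
  by_cases hzT : z ∈ ω.erase x
  · refine le_of_le_of_eq le_top (Eq.symm ?_)
    refine ENNReal.sum_eq_top.2 ⟨z, hzT, ?_⟩
    rw [edist_self, ENNReal.zero_rpow_of_neg (by linarith)]
  have h1 : rieszEnergy s ω ≤ rieszEnergy s (insert z (ω.erase x)) := by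
    rw [hω]
    refine iInf_le_of_le _ (iInf_le_of_le ?_ (iInf_le _ ?_))
    · rw [Finset.coe_insert]
      exact insert_subset hz fun y hy => hωA (Finset.mem_of_mem_erase hy)
    · rw [Finset.card_insert_of_notMem hzT, Finset.card_erase_add_one hx]
  rw [← Finset.insert_erase hx, rieszEnergy_insert s (Finset.notMem_erase x ω),
    Finset.erase_insert (Finset.notMem_erase x ω), rieszEnergy_insert s hzT,
    ENNReal.add_le_add_iff_left (rieszEnergy_ne_top hs _),
    ENNReal.mul_le_mul_iff_right (by simp) (by simp)] at h1
  exact h1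

section Haar

variable {E : Type*} [NormedAddCommGroup E] [NormedSpace ℝ E] [MeasurableSpace E] [BorelSpace E]
  [FiniteDimensional ℝ E] (μ : Measure E) [μ.IsAddHaarMeasure]

theorem lintegral_inv_smul (f : E → ℝ≥0∞) {r : ℝ} (hr : 0 < r) :
    ∫⁻ z, f (r⁻¹ • z) ∂μ = ENNReal.ofReal (r ^ Module.finrank ℝ E) * ∫⁻ z, f z ∂μ := by
  rw [← (measurableEmbedding_const_smul₀ (inv_ne_zero hr.ne')).lintegral_map f,
    Measure.map_addHaar_smul μ (inv_ne_zero hr.ne'), lintegral_smul_measure, smul_eq_mul,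
    inv_pow, inv_inv, abs_of_pos (pow_pos hr _)]

/-- The integral of the Riesz kernel outside a ball of radius `r`. -/
theorem setLIntegral_edist_rpow_le {s r : ℝ} (hs : 0 < s) (hr : 0 < r) (y : E) :
    ∫⁻ z in (ball y r)ᶜ, edist z y ^ (-s) ∂μ ≤
      ENNReal.ofReal (2 ^ s * r ^ (-s) * r ^ Module.finrank ℝ E) *
        ∫⁻ z, ENNReal.ofReal ((1 + ‖z‖) ^ (-s)) ∂μ := by
  set f : E → ℝ≥0∞ := fun z => ENNReal.ofReal ((1 + ‖z‖) ^ (-s)) with hf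
  have hfm : Measurable f := by
    rw [hf]; fun_prop
  calc ∫⁻ z in (ball y r)ᶜ, edist z y ^ (-s) ∂μ
      ≤ ∫⁻ z in (ball y r)ᶜ, ENNReal.ofReal (2 ^ s * r ^ (-s)) * f (r⁻¹ • (z - y)) ∂μ := by
        refine setLIntegral_mono' measurableSet_ball.compl fun z hz => ?_
        have hz' : r ≤ dist z y := by simpa using hz
        have hpos : 0 < dist z y := hr.trans_le hz'
        rw [edist_dist, ENNReal.ofReal_rpow_of_pos hpos, hf, ← ENNReal.ofReal_mul (by positivity)]
        refine ENNReal.ofReal_le_ofReal ?_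
        have h2 : (2 : ℝ) ^ s = (2⁻¹ : ℝ) ^ (-s) := by
          rw [Real.inv_rpow (by norm_num), Real.rpow_neg (by norm_num), inv_inv]
        rw [h2, ← Real.mul_rpow (by positivity) hr.le,
          ← Real.mul_rpow (by positivity) (by positivity)]
        refine Real.rpow_le_rpow_of_nonpos (by positivity) ?_ (by linarith)
        rw [norm_smul, ← dist_eq_norm, norm_inv, Real.norm_of_nonneg hr.le]
        field_simp
        linarith
    _ ≤ ∫⁻ z, ENNReal.ofReal (2 ^ s * r ^ (-s)) * f (r⁻¹ • (z - y)) ∂μ :=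
        setLIntegral_le_lintegral _ _
    _ = _ := by
        rw [lintegral_const_mul _ (by fun_prop),
          lintegral_sub_right_eq_self (fun z => f (r⁻¹ • z)) y, lintegral_inv_smul μ f hr,
          ← mul_assoc, ← ENNReal.ofReal_mul (by positivity)]

/-- If small balls around the points of `T` fill at most half of `A`, then the least value on `A`
of the potential of `T` is controlled by the radius of these balls. -/
theorem mul_measure_half_le_of_le_potential {s r : ℝ} (hs : 0 < s) (hr : 0 < r)
    {A : Set E} (hA : MeasurableSet A) (hA_fin : μ A ≠ ⊤) {T : Finset E}
    (hT : ∑ y ∈ T, μ (ball y r) ≤ μ A / 2) {c : ℝ≥0∞}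
    (hc : ∀ z ∈ A, c ≤ ∑ y ∈ T, edist z y ^ (-s)) :
    c * (μ A / 2) ≤ T.card * (ENNReal.ofReal (2 ^ s * r ^ (-s) * r ^ Module.finrank ℝ E) *
        ∫⁻ z, ENNReal.ofReal ((1 + ‖z‖) ^ (-s)) ∂μ) := by
  set D := A \ ⋃ y ∈ T, ball y r with hD
  have hDm : MeasurableSet D :=
    hA.diff (Finset.measurableSet_biUnion _ fun _ _ => measurableSet_ball)
  have hDvol : μ A / 2 ≤ μ D := by
    calc μ A / 2 = μ A - μ A / 2 := (ENNReal.sub_half hA_fin).symm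
      _ ≤ μ A - μ (⋃ y ∈ T, ball y r) :=
        tsub_le_tsub_left ((measure_biUnion_finset_le _ _).trans hT) _
      _ ≤ μ D := le_measure_sdiff
  calc c * (μ A / 2) ≤ c * μ D := by gcongr
    _ = ∫⁻ _ in D, c ∂μ := (setLIntegral_const _ _).symm
    _ ≤ ∫⁻ z in D, ∑ y ∈ T, edist z y ^ (-s) ∂μ :=
        setLIntegral_mono' hDm fun z hz => hc z hz.1
    _ = ∑ y ∈ T, ∫⁻ z in D, edist z y ^ (-s) ∂μ :=
        lintegral_finsetSum _ fun y _ => by fun_prop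
    _ ≤ ∑ y ∈ T, (ENNReal.ofReal (2 ^ s * r ^ (-s) * r ^ Module.finrank ℝ E) *
        ∫⁻ z, ENNReal.ofReal ((1 + ‖z‖) ^ (-s)) ∂μ) := by
        refine Finset.sum_le_sum fun y hy => ?_
        refine (lintegral_mono_set ?_).trans (setLIntegral_edist_rpow_le μ hs hr y)
        exact fun z hz hzy => hz.2 (mem_biUnion hy hzy)
    _ = _ := by rw [Finset.sum_const, nsmul_eq_mul]

end Haar

/-- separation of optimal `s`-energy configurations, `s > d`:
`min_{i≠j} |x_i - x_j| ≥ C N^{-1/d}`. -/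
theorem separation_of_optimal_config (d : ℕ) (hd : 1 ≤ d) (s : ℝ) (hs : (d : ℝ) < s)
    (A : Set (EuclideanSpace ℝ (Fin d))) (hA : IsCompact A) (hA0 : 0 < volume A) :
    ∃ C : ℝ, 0 < C ∧ ∀ N : ℕ, 2 ≤ N →
      ∀ ω : Finset (EuclideanSpace ℝ (Fin d)), ↑ω ⊆ A → ω.card = N →
        rieszEnergy s ω = minRieszEnergy s A N →
          ∀ x ∈ ω, ∀ y ∈ ω, x ≠ y → C * (N : ℝ) ^ (-(1 / (d : ℝ))) ≤ dist x y := by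
  have hd0 : (0 : ℝ) < d := by exact_mod_cast hd
  have hs0 : 0 < s := hd0.trans hs
  have : Nonempty (Fin d) := ⟨⟨0, hd⟩⟩
  have hfr : Module.finrank ℝ (EuclideanSpace ℝ (Fin d)) = d := finrank_euclideanSpace_fin
  have hA_fin : volume A ≠ ⊤ := hA.measure_lt_top.ne
  set V := (volume A).toReal with hV
  have hVpos : 0 < V := ENNReal.toReal_pos hA0.ne' hA_fin
  have hVA : volume A / 2 = ENNReal.ofReal (V / 2) := by
    rw [ENNReal.ofReal_div_of_pos two_pos, hV, ENNReal.ofReal_toReal hA_fin, ENNReal.ofReal_ofNat]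
  set B := volume (ball (0 : EuclideanSpace ℝ (Fin d)) 1) with hB
  have hB_fin : B ≠ ⊤ := measure_ball_lt_top.ne
  set v := B.toReal with hv
  have hvpos : 0 < v := ENNReal.toReal_pos (measure_ball_pos _ _ one_pos).ne' hB_fin
  have hBv : B = ENNReal.ofReal v := (ENNReal.ofReal_toReal hB_fin).symm
  set J := ∫⁻ z : EuclideanSpace ℝ (Fin d), ENNReal.ofReal ((1 + ‖z‖) ^ (-s)) with hJ
  have hJ_fin : J ≠ ⊤ := (finite_integral_one_add_norm (by rwa [hfr])).ne
  set I := J.toReal with hI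
  have hJI : J = ENNReal.ofReal I := (ENNReal.ofReal_toReal hJ_fin).symm
  have hI0 : 0 ≤ I := ENNReal.toReal_nonneg
  set ρ : ℝ := (V / (2 * v)) ^ (1 / (d : ℝ)) with hρ
  have hρpos : 0 < ρ := by positivity
  have hρd : ρ ^ d = V / (2 * v) := by
    rw [hρ, ← Real.rpow_natCast, ← Real.rpow_mul (by positivity), one_div_mul_cancel hd0.ne',
      Real.rpow_one]
  set M : ℝ := 2 / V * (2 ^ s * ρ ^ (-s) * ρ ^ d * I) + 1 with hM
  have hMpos : 0 < M := by positivity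
  refine ⟨M ^ (-(1 / s)), by positivity, fun N hN ω hωA hcard hω x hx y hy hxy => ?_⟩
  have hN0 : (0 : ℝ) < N := by exact_mod_cast (by omega : 0 < N)
  set t : ℝ := (N : ℝ) ^ (-(1 / (d : ℝ))) with ht
  have htpos : 0 < t := by positivity
  have htd : t ^ d = (N : ℝ)⁻¹ := by
    rw [ht, ← Real.rpow_natCast, ← Real.rpow_mul hN0.le, neg_mul, one_div_mul_cancel hd0.ne',
      Real.rpow_neg_one]
  have hrpos : 0 < ρ * t := by positivity
  have hTcard : (ω.erase x).card ≤ N := hcard ▸ Finset.card_le_card (Finset.erase_subset _ _)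
  have hballs : ∑ y ∈ ω.erase x, volume (ball y (ρ * t)) ≤ volume A / 2 := by
    have hb : ∀ y : EuclideanSpace ℝ (Fin d),
        volume (ball y (ρ * t)) = ENNReal.ofReal ((ρ * t) ^ d * v) := fun y => by
      rw [Measure.addHaar_ball volume y hrpos.le, hfr, ← hB, hBv,
        ← ENNReal.ofReal_mul (by positivity)]
    calc ∑ y ∈ ω.erase x, volume (ball y (ρ * t))
        = (ω.erase x).card * ENNReal.ofReal ((ρ * t) ^ d * v) := by
          simp only [hb, Finset.sum_const, nsmul_eq_mul]
      _ ≤ N * ENNReal.ofReal ((ρ * t) ^ d * v) := by gcongr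
      _ = volume A / 2 := by
          rw [hVA, ← ENNReal.ofReal_natCast, ← ENNReal.ofReal_mul hN0.le, mul_pow, hρd, htd]
          congr 1
          field_simp
  have key := mul_measure_half_le_of_le_potential volume hs0 hrpos hA.measurableSet hA_fin hballs
    (c := ∑ y ∈ ω.erase x, edist x y ^ (-s)) fun z hz => by
      convert potential_le_of_rieszEnergy_eq_min hs0 hωA (hcard ▸ hω) hx hz
  have hyT : y ∈ ω.erase x := Finset.mem_erase.2 ⟨hxy.symm, hy⟩
  have hdist : 0 < dist x y := dist_pos.2 hxy
  have key' : edist x y ^ (-s) * (volume A / 2) ≤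
      N * (ENNReal.ofReal (2 ^ s * (ρ * t) ^ (-s) * (ρ * t) ^ d) * J) := by
    rw [hfr] at key
    calc edist x y ^ (-s) * (volume A / 2)
        ≤ (∑ y ∈ ω.erase x, edist x y ^ (-s)) * (volume A / 2) := by
          gcongr
          exact Finset.single_le_sum (f := fun y => edist x y ^ (-s)) (fun _ _ => zero_le) hyT
      _ ≤ _ := key
      _ ≤ _ := by gcongr
  rw [edist_dist, ENNReal.ofReal_rpow_of_pos hdist, hVA, hJI, ← ENNReal.ofReal_mul (by positivity),
    ← ENNReal.ofReal_mul (by positivity), ← ENNReal.ofReal_natCast,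
    ← ENNReal.ofReal_mul (by positivity), ENNReal.ofReal_le_ofReal_iff (by positivity)] at key'
  refine (Real.rpow_le_rpow_iff_of_neg hdist (by positivity) (neg_lt_zero.2 hs0)).1 ?_
  have hMs : (M ^ (-(1 / s))) ^ (-s) = M := by
    rw [← Real.rpow_mul hMpos.le, neg_mul_neg, one_div_mul_cancel hs0.ne', Real.rpow_one]
  rw [Real.mul_rpow (by positivity) htpos.le, hMs]
  have hts : 0 < t ^ (-s) := by positivity
  calc dist x y ^ (-s) = 2 / V * (dist x y ^ (-s) * (V / 2)) := by field_simp
    _ ≤ 2 / V * (N * (2 ^ s * (ρ * t) ^ (-s) * (ρ * t) ^ d * I)) := by gcongr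
    _ = 2 / V * (2 ^ s * ρ ^ (-s) * ρ ^ d * I) * t ^ (-s) := by
        rw [Real.mul_rpow hρpos.le htpos.le, mul_pow, htd]
        field_simp
    _ ≤ M * t ^ (-s) := by
        gcongr
        linarith
end

section
/- Fix integers 1 ≤ d ≤ d' and a real s > d. Let A ⊆ ℝ^{d'} be a d-rectifiable manifold. Then lim_{N→∞} ℰ_s(A,N)/N^{1+s/d} exists in [0,∞] and equals C_{s,d}/H_d(A)^{s/d}, where C_{s,d} ∈ (0,∞) is the constant for which lim_{N→∞} ℰ_s(K,N)/N^{1+s/d} = C_{s,d}/H_d(K)^{s/d} for every compact K ⊆ ℝ^d; equivalently, C_{s,d} = lim_{N→∞} ℰ_s([0,1]^d, N)/N^{1+s/d}. (The limit is +∞ when H_d(A) = 0.) -/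
open scoped ENNReal NNReal BigOperators Classical
open MeasureTheory Filter Metric Set Topology

/-- `A ⊆ ℝ^{d'}` is a `d`-rectifiable manifold: a finite union of images of compact subsets
of `ℝ^d` under maps that are bi-Lipschitz on open neighborhoods of those compact sets. -/
def IsRectifiableManifold (d d' : ℕ) (A : Set (EuclideanSpace ℝ (Fin d'))) : Prop :=
  ∃ (n : ℕ) (K : Fin n → Set (EuclideanSpace ℝ (Fin d)))
    (φ : Fin n → EuclideanSpace ℝ (Fin d) → EuclideanSpace ℝ (Fin d')),
    (∀ k, IsCompact (K k)) ∧
    (∀ k, ∃ (G : Set (EuclideanSpace ℝ (Fin d))) (L : ℝ), IsOpen G ∧ K k ⊆ G ∧ 1 ≤ L ∧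
      ∀ x ∈ G, ∀ y ∈ G,
        (1 / L) * dist x y ≤ dist (φ k x) (φ k y) ∧ dist (φ k x) (φ k y) ≤ L * dist x y) ∧
    A = ⋃ k, φ k '' K k

/-- The unit cube `[0,1]^d` in `ℝ^d`. -/
def unitCube (d : ℕ) : Set (EuclideanSpace ℝ (Fin d)) := {x | ∀ i, x i ∈ Set.Icc (0 : ℝ) 1}

/-- `d`-dimensional Hausdorff measure on `ℝ^{d'}`, normalized so that the unit cube of `ℝ^d`
has measure `1`. -/
noncomputable def normHausdorff (d d' : ℕ) : Measure (EuclideanSpace ℝ (Fin d')) :=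
  (μH[(d : ℝ)] (unitCube d))⁻¹ • μH[(d : ℝ)]

theorem rieszEnergy_mono {E : Type*} [PseudoEMetricSpace E] (s : ℝ) {ω ω' : Finset E}
    (h : ω ⊆ ω') : rieszEnergy s ω ≤ rieszEnergy s ω' :=
  (Finset.sum_le_sum fun _ _ => Finset.sum_le_sum_of_subset h).trans
    (Finset.sum_le_sum_of_subset h)

theorem minRieszEnergy_anti {E : Type*} [PseudoEMetricSpace E] (s : ℝ) {A B : Set E}
    (h : A ⊆ B) (N : ℕ) : minRieszEnergy s B N ≤ minRieszEnergy s A N :=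
  le_iInf fun ω => le_iInf fun hω => le_iInf fun hN =>
    (iInf_le_of_le ω (iInf_le_of_le (hω.trans h) (iInf_le _ hN)))

theorem exists_rieszEnergy_lt {E : Type*} [PseudoEMetricSpace E] {s : ℝ} {A : Set E} {N : ℕ}
    {b : ℝ≥0∞} (h : minRieszEnergy s A N < b) :
    ∃ ω : Finset E, ↑ω ⊆ A ∧ ω.card = N ∧ rieszEnergy s ω < b := by
  simpa only [minRieszEnergy, iInf_lt_iff, exists_prop] using h

theorem minRieszEnergy_card_le {E F : Type*} [MetricSpace E] [MetricSpace F] {s : ℝ} (hs : 0 ≤ s)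
    {ω : Finset E} {f : E → F} {B : Set F} (hB : ∀ x ∈ ω, f x ∈ B) {L a : ℝ} (hL : 0 < L)
    (ha : 0 < a)
    (hf : ∀ x ∈ ω, ∀ y ∈ ω, dist x y ≤ L * dist (f x) (f y) ∨ a ≤ dist (f x) (f y)) :
    minRieszEnergy s B ω.card ≤ ENNReal.ofReal (L ^ s) * rieszEnergy s ω +
      ENNReal.ofReal (a ^ (-s)) * (ω.card : ℝ≥0∞) ^ 2 := by
  have hinj : Set.InjOn f ω := by
    intro x hx y hy hxy
    by_contra hne
    rcases hf x hx y hy with h | h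
    · rw [hxy, dist_self, mul_zero] at h
      exact hne (dist_le_zero.1 h)
    · rw [hxy, dist_self] at h
      exact absurd h (not_le.2 ha)
  have hcard : (ω.image f).card = ω.card := Finset.card_image_of_injOn hinj
  have hsub : (↑(ω.image f) : Set F) ⊆ B := by
    intro z hz
    obtain ⟨x, hx, rfl⟩ := Finset.mem_image.1 (Finset.mem_coe.1 hz)
    exact hB x hx
  have hmin : minRieszEnergy s B ω.card ≤ rieszEnergy s (ω.image f) :=
    iInf_le_of_le _ (iInf_le_of_le hsub (iInf_le _ hcard))
  refine hmin.trans ?_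
  have key : ∀ x ∈ ω, ∀ y ∈ ω, (if f x = f y then 0 else edist (f x) (f y) ^ (-s)) ≤
      ENNReal.ofReal (L ^ s) * (if x = y then 0 else edist x y ^ (-s)) +
        ENNReal.ofReal (a ^ (-s)) := by
    intro x hx y hy
    by_cases hxy : x = y
    · simp [hxy]
    have hfxy : f x ≠ f y := fun h => hxy (hinj hx hy h)
    rw [if_neg hxy, if_neg hfxy]
    have hd : 0 < dist x y := dist_pos.2 hxy
    have hd' : 0 < dist (f x) (f y) := dist_pos.2 hfxy
    rw [edist_dist, edist_dist, ENNReal.ofReal_rpow_of_pos hd, ENNReal.ofReal_rpow_of_pos hd',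
      ← ENNReal.ofReal_mul (by positivity), ← ENNReal.ofReal_add (by positivity) (by positivity)]
    apply ENNReal.ofReal_le_ofReal
    rcases hf x hx y hy with h | h
    · have h1 : dist (f x) (f y) ^ (-s) ≤ (dist x y / L) ^ (-s) :=
        Real.rpow_le_rpow_of_nonpos (by positivity) (by rwa [div_le_iff₀' hL]) (by linarith)
      have h2 : (dist x y / L) ^ (-s) = L ^ s * dist x y ^ (-s) := by
        rw [Real.div_rpow hd.le hL.le, Real.rpow_neg hL.le, div_inv_eq_mul, mul_comm]
      have : 0 ≤ a ^ (-s) := by positivity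
      linarith
    · have h1 : dist (f x) (f y) ^ (-s) ≤ a ^ (-s) :=
        Real.rpow_le_rpow_of_nonpos ha h (by linarith)
      have : 0 ≤ L ^ s * dist x y ^ (-s) := by positivity
      linarith
  calc rieszEnergy s (ω.image f)
      = ∑ x ∈ ω, ∑ y ∈ ω, (if f x = f y then 0 else edist (f x) (f y) ^ (-s)) := by
        rw [rieszEnergy, Finset.sum_image hinj]
        exact Finset.sum_congr rfl fun x _ => Finset.sum_image hinj
    _ ≤ ∑ x ∈ ω, ∑ y ∈ ω, (ENNReal.ofReal (L ^ s) * (if x = y then 0 else edist x y ^ (-s)) +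
        ENNReal.ofReal (a ^ (-s))) :=
        Finset.sum_le_sum fun x hx => Finset.sum_le_sum fun y hy => key x hx y hy
    _ = _ := by
        simp only [Finset.sum_add_distrib, Finset.sum_const, nsmul_eq_mul, ← Finset.mul_sum,
          rieszEnergy]
        ring

/-- `f` is bi-Lipschitz on `S` with constant `L`. -/
def BiLipschitzOnWith {X Y : Type*} [PseudoMetricSpace X] [PseudoMetricSpace Y] (L : ℝ≥0)
    (f : X → Y) (S : Set X) : Prop :=
  ∀ x ∈ S, ∀ y ∈ S, dist (f x) (f y) ≤ L * dist x y ∧ dist x y ≤ L * dist (f x) (f y)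

namespace BiLipschitzOnWith

section
variable {X Y : Type*} [MetricSpace X] [MetricSpace Y] {L : ℝ≥0} {f : X → Y} {S T : Set X}

theorem mono (h : BiLipschitzOnWith L f S) (hT : T ⊆ S) : BiLipschitzOnWith L f T :=
  fun x hx y hy => h x (hT hx) y (hT hy)

theorem weaken {L' : ℝ≥0} (h : BiLipschitzOnWith L f S) (hL : L ≤ L') :
    BiLipschitzOnWith L' f S := fun x hx y hy =>
  ⟨(h x hx y hy).1.trans (by gcongr), (h x hx y hy).2.trans (by gcongr)⟩

theorem lipschitzOnWith (h : BiLipschitzOnWith L f S) : LipschitzOnWith L f S :=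
  LipschitzOnWith.of_dist_le_mul fun x hx y hy => (h x hx y hy).1

theorem injOn (h : BiLipschitzOnWith L f S) : InjOn f S := by
  intro x hx y hy hxy
  have := (h x hx y hy).2
  rw [hxy, dist_self, mul_zero] at this
  exact dist_le_zero.1 this

theorem of_leftInvOn (h : BiLipschitzOnWith L f S) {g : Y → X} (hg : LeftInvOn g f S) :
    BiLipschitzOnWith L g (f '' S) := by
  rintro _ ⟨x, hx, rfl⟩ _ ⟨y, hy, rfl⟩
  rw [hg hx, hg hy]
  exact (h x hx y hy).symm

end

end BiLipschitzOnWith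

theorem unitCube_eq_preimage (d : ℕ) :
    unitCube d = (WithLp.ofLp : EuclideanSpace ℝ (Fin d) → (Fin d → ℝ)) ⁻¹' Icc 0 1 := by
  ext x
  simp [unitCube, Pi.le_def, forall_and]

theorem volume_unitCube (d : ℕ) : volume (unitCube d) = 1 := by
  rw [unitCube_eq_preimage, (PiLp.volume_preserving_ofLp (Fin d)).measure_preimage
    measurableSet_Icc.nullMeasurableSet, Real.volume_Icc_pi]
  simp

theorem isAddHaarMeasure_hausdorffMeasure_euclidean (d : ℕ) :
    (μH[(d : ℝ)] : Measure (EuclideanSpace ℝ (Fin d))).IsAddHaarMeasure := by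
  simpa using MeasureTheory.isAddHaarMeasure_hausdorffMeasure (E := EuclideanSpace ℝ (Fin d))

theorem normHausdorff_self (d : ℕ) : normHausdorff d d = volume := by
  have := isAddHaarMeasure_hausdorffMeasure_euclidean d
  obtain ⟨c, hc⟩ : ∃ c : ℝ≥0, (μH[(d : ℝ)] : Measure (EuclideanSpace ℝ (Fin d))) = c • volume :=
    ⟨_, Measure.isAddLeftInvariant_eq_smul _ _⟩
  have hc0 : c ≠ 0 := by
    rintro rfl
    have h := isOpen_univ.measure_ne_zero
      (μH[(d : ℝ)] : Measure (EuclideanSpace ℝ (Fin d))) univ_nonempty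
    simp [hc] at h
  have hcube : (μH[(d : ℝ)] : Measure (EuclideanSpace ℝ (Fin d))) (unitCube d) = c := by
    rw [hc, Measure.smul_apply, volume_unitCube, ENNReal.smul_def, smul_eq_mul, mul_one]
  rw [normHausdorff, hcube, hc, ← ENNReal.coe_inv hc0]
  ext t
  rw [Measure.smul_apply, Measure.smul_apply, ENNReal.smul_def, smul_eq_mul, smul_eq_mul,
    ← mul_assoc, ← ENNReal.coe_mul, inv_mul_cancel₀ hc0, ENNReal.coe_one, one_mul]

theorem normHausdorff_image_le {d m n : ℕ} {L : ℝ≥0}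
    {f : EuclideanSpace ℝ (Fin m) → EuclideanSpace ℝ (Fin n)} {S : Set (EuclideanSpace ℝ (Fin m))}
    (h : LipschitzOnWith L f S) :
    normHausdorff d n (f '' S) ≤ (L : ℝ≥0∞) ^ d * normHausdorff d m S := by
  have := h.hausdorffMeasure_image_le (d := d) (by positivity)
  simp only [normHausdorff, Measure.smul_apply, smul_eq_mul]
  calc _ ≤ _ := mul_le_mul_right this _
    _ = _ := by rw [ENNReal.rpow_natCast]; ring

theorem exists_linearMap_norm_eq {d : ℕ} {F : Type*} [NormedAddCommGroup F]
    [InnerProductSpace ℝ F] (A : EuclideanSpace ℝ (Fin d) →ₗ[ℝ] F) :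
    ∃ B : EuclideanSpace ℝ (Fin d) →ₗ[ℝ] EuclideanSpace ℝ (Fin d), ∀ v, ‖B v‖ = ‖A v‖ := by
  have hfin : Module.finrank ℝ (LinearMap.range A) ≤ d := by
    simpa using LinearMap.finrank_range_le A
  let b := stdOrthonormalBasis ℝ (LinearMap.range A)
  let v : Fin (Module.finrank ℝ (LinearMap.range A)) → EuclideanSpace ℝ (Fin d) :=
    fun i => EuclideanSpace.basisFun (Fin d) ℝ (Fin.castLE hfin i)
  have hv : Orthonormal ℝ v :=
    (EuclideanSpace.basisFun (Fin d) ℝ).orthonormal.comp _ (Fin.castLE_injective hfin)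
  let T := b.toBasis.constr ℝ v
  have hT : ⇑T ∘ ⇑b.toBasis = v := by
    ext1 i
    exact b.toBasis.constr_basis ℝ v i
  let I := T.isometryOfOrthonormal (v := b.toBasis) (by simp [b.orthonormal]) (by rwa [hT])
  refine ⟨I.toLinearMap ∘ₗ A.rangeRestrict, fun w => ?_⟩
  have h1 : (I.toLinearMap ∘ₗ A.rangeRestrict) w = I (A.rangeRestrict w) := rfl
  rw [h1, I.norm_map]
  rfl

theorem exists_cover_biLipschitzOnWith {d d' : ℕ}
    {f : EuclideanSpace ℝ (Fin d) → EuclideanSpace ℝ (Fin d')}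
    {U : Set (EuclideanSpace ℝ (Fin d))} (hU : IsOpen U) {L₀ : ℝ≥0} (hL₀ : 0 < L₀)
    (hf : BiLipschitzOnWith L₀ f U) {L : ℝ≥0} (hL : 1 < L) :
    ∃ P : ℕ → Set (EuclideanSpace ℝ (Fin d)), (∀ n, MeasurableSet (P n)) ∧ (∀ n, P n ⊆ U) ∧
      volume (U \ ⋃ n, P n) = 0 ∧
      ∀ n, ∃ g : EuclideanSpace ℝ (Fin d') → EuclideanSpace ℝ (Fin d),
        BiLipschitzOnWith L g (f '' P n) := by
  set S := U ∩ {x | DifferentiableAt ℝ f x} with hS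
  have hSm : MeasurableSet S := hU.measurableSet.inter (measurableSet_of_differentiableAt ℝ f)
  have hL0 : 0 < L := zero_lt_one.trans hL
  set ε : ℝ≥0 := 1 - L⁻¹ with hε
  have hinv : L⁻¹ < 1 := inv_lt_one_of_one_lt₀ hL
  have hε0 : 0 < ε := tsub_pos_of_lt hinv
  have hεr : (ε : ℝ) = 1 - (L : ℝ)⁻¹ := by
    rw [hε, NNReal.coe_sub hinv.le]; simp
  have hLr : (1 : ℝ) < L := by exact_mod_cast hL
  obtain ⟨t, A, -, htm, hcov, happ, -⟩ :=
    exists_partition_approximatesLinearOn_of_hasFDerivWithinAt f S (fderiv ℝ f)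
      (fun x hx => hx.2.hasFDerivAt.hasFDerivWithinAt) (fun _ => ε / L₀)
      (fun _ => (div_pos hε0 hL₀).ne')
  refine ⟨fun n => S ∩ t n, fun n => hSm.inter (htm n), fun n x hx => hx.1.1, ?_, fun n => ?_⟩
  · have h1 : U \ ⋃ n, S ∩ t n ⊆ U \ S := by
      rintro x ⟨hx, hx'⟩
      refine ⟨hx, fun hxS => hx' ?_⟩
      rw [← inter_iUnion]
      exact ⟨hxS, hcov hxS⟩
    refine measure_mono_null h1 ?_
    have h2 := hf.lipschitzOnWith.ae_differentiableWithinAt_of_mem (μ := volume)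
    rw [ae_iff] at h2
    refine measure_mono_null ?_ h2
    rintro x ⟨hx, hx'⟩ h
    exact hx' ⟨hx, (h hx).differentiableAt (hU.mem_nhds hx)⟩
  · have hfP : BiLipschitzOnWith L₀ f (S ∩ t n) := hf.mono fun x hx => hx.1.1
    obtain ⟨B, hB⟩ := exists_linearMap_norm_eq (A n).toLinearMap
    refine ⟨fun z => B (Function.invFunOn f (S ∩ t n) z), ?_⟩
    rintro _ ⟨x, hx, rfl⟩ _ ⟨y, hy, rfl⟩
    simp only []
    rw [hfP.injOn.leftInvOn_invFunOn hx, hfP.injOn.leftInvOn_invFunOn hy,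
      dist_eq_norm (B x), ← map_sub, hB]
    have h1 := happ n x hx y hy
    have h2 := (hfP x hx y hy).2
    rw [dist_eq_norm, dist_eq_norm] at h2
    rw [dist_eq_norm]
    have h3 : ‖f x - f y - (A n) (x - y)‖ ≤ ε * ‖f x - f y‖ := by
      refine h1.trans ?_
      rw [NNReal.coe_div, div_mul_eq_mul_div, div_le_iff₀ (by exact_mod_cast hL₀), mul_assoc]
      rw [mul_comm ‖f x - f y‖]
      gcongr
    have h4 := abs_le.1 ((abs_norm_sub_norm_le (f x - f y) ((A n) (x - y))).trans h3)
    have hi : (L : ℝ) * (L : ℝ)⁻¹ = 1 := mul_inv_cancel₀ (by positivity)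
    have hi2 : 2 - (L : ℝ)⁻¹ ≤ L := by nlinarith [sq_nonneg ((L : ℝ) - 1), inv_pos.2 (zero_lt_one.trans hLr)]
    have hn := norm_nonneg (f x - f y)
    rw [hεr] at h4
    change ‖A n (x - y)‖ ≤ _ ∧ _ ≤ _ * ‖A n (x - y)‖
    constructor
    · calc ‖A n (x - y)‖ ≤ (2 - (L : ℝ)⁻¹) * ‖f x - f y‖ := by linarith [h4.1]
        _ ≤ L * ‖f x - f y‖ := by gcongr
    · have : (L : ℝ)⁻¹ * ‖f x - f y‖ ≤ ‖A n (x - y)‖ := by linarith [h4.2]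
      calc ‖f x - f y‖ = L * ((L : ℝ)⁻¹ * ‖f x - f y‖) := by rw [← mul_assoc, hi, one_mul]
        _ ≤ _ := by gcongr

theorem IsRectifiableManifold.exists_charts {d d' : ℕ} {A : Set (EuclideanSpace ℝ (Fin d'))}
    (hA : IsRectifiableManifold d d' A) :
    ∃ (n : ℕ) (K G : Fin n → Set (EuclideanSpace ℝ (Fin d)))
      (φ : Fin n → EuclideanSpace ℝ (Fin d) → EuclideanSpace ℝ (Fin d')) (L₀ : ℝ≥0),
      1 ≤ L₀ ∧ (∀ k, IsCompact (K k)) ∧ (∀ k, IsOpen (G k)) ∧ (∀ k, K k ⊆ G k) ∧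
        (∀ k, BiLipschitzOnWith L₀ (φ k) (G k)) ∧ A = ⋃ k, φ k '' K k := by
  obtain ⟨n, K, φ, hK, hφ, hAeq⟩ := hA
  choose G L hG hKG hL hbi using hφ
  refine ⟨n, K, G, φ, 1 + ∑ k, (L k).toNNReal, le_self_add, hK, hG, hKG, fun k => ?_, hAeq⟩
  have hk : BiLipschitzOnWith (L k).toNNReal (φ k) (G k) := by
    intro x hx y hy
    have h0 : 0 < L k := zero_lt_one.trans_le (hL k)
    rw [Real.coe_toNNReal _ h0.le]
    refine ⟨(hbi k x hx y hy).2, ?_⟩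
    have := (hbi k x hx y hy).1
    rwa [one_div, inv_mul_le_iff₀ h0] at this
  exact hk.weaken ((Finset.single_le_sum (f := fun k => (L k).toNNReal) (fun _ _ => zero_le)
    (Finset.mem_univ k)).trans le_add_self)

theorem IsRectifiableManifold.isCompact {d d' : ℕ} {A : Set (EuclideanSpace ℝ (Fin d'))}
    (hA : IsRectifiableManifold d d' A) : IsCompact A := by
  obtain ⟨n, K, G, φ, L₀, -, hK, -, hKG, hφ, rfl⟩ := hA.exists_charts
  exact isCompact_iUnion fun k =>
    (hK k).image_of_continuousOn ((hφ k).mono (hKG k)).lipschitzOnWith.continuousOn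

theorem IsRectifiableManifold.normHausdorff_lt_top {d d' : ℕ}
    {A : Set (EuclideanSpace ℝ (Fin d'))} (hA : IsRectifiableManifold d d' A) :
    normHausdorff d d' A < ∞ := by
  obtain ⟨n, K, G, φ, L₀, -, hK, -, hKG, hφ, rfl⟩ := hA.exists_charts
  refine (measure_iUnion_le _).trans_lt ?_
  rw [tsum_fintype, ENNReal.sum_lt_top]
  intro k _
  refine (normHausdorff_image_le ((hφ k).mono (hKG k)).lipschitzOnWith).trans_lt ?_
  rw [normHausdorff_self]
  exact ENNReal.mul_lt_top (ENNReal.pow_lt_top ENNReal.coe_lt_top) (hK k).measure_lt_top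

theorem IsRectifiableManifold.exists_measurable_cover {d d' : ℕ}
    {A : Set (EuclideanSpace ℝ (Fin d'))} (hA : IsRectifiableManifold d d' A) {L : ℝ≥0}
    (hL : 1 < L) :
    ∃ P : ℕ → Set (EuclideanSpace ℝ (Fin d')), (∀ n, MeasurableSet (P n)) ∧ (∀ n, P n ⊆ A) ∧
      Pairwise (Function.onFun Disjoint P) ∧ normHausdorff d d' (A \ ⋃ n, P n) = 0 ∧
      ∀ n, ∃ g : EuclideanSpace ℝ (Fin d') → EuclideanSpace ℝ (Fin d),
        BiLipschitzOnWith L g (P n) := by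
  obtain ⟨n, K, G, φ, L₀, hL₀, hK, hG, hKG, hφ, rfl⟩ := hA.exists_charts
  choose T hTm hTU hT0 g hg using fun k =>
    exists_cover_biLipschitzOnWith (hG k) (zero_lt_one.trans_le hL₀) (hφ k) hL
  let R : Fin n × ℕ → Set (EuclideanSpace ℝ (Fin d')) := fun p => φ p.1 '' (K p.1 ∩ T p.1 p.2)
  let Q : ℕ → Set (EuclideanSpace ℝ (Fin d')) := fun m =>
    ⋃ p ∈ Encodable.decode₂ (Fin n × ℕ) m, R p
  have hQU : ⋃ m, Q m = ⋃ p, R p := Encodable.iUnion_decode₂ R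
  have hRm : ∀ p, MeasurableSet (R p) := fun p => by
    have hbi : BiLipschitzOnWith L₀ (φ p.1) (K p.1 ∩ T p.1 p.2) :=
      (hφ p.1).mono fun x hx => hKG _ hx.1
    exact ((hK _).measurableSet.inter (hTm _ _)).image_of_continuousOn_injOn
      hbi.lipschitzOnWith.continuousOn hbi.injOn
  have hQm : ∀ m, MeasurableSet (Q m) := fun m =>
    Encodable.iUnion_decode₂_cases (C := MeasurableSet) MeasurableSet.empty hRm
  refine ⟨disjointed Q, MeasurableSet.disjointed hQm, fun m => ?_, disjoint_disjointed Q, ?_,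
    fun m => ?_⟩
  · refine (disjointed_subset Q m).trans ?_
    refine Encodable.iUnion_decode₂_cases (C := fun S => S ⊆ ⋃ k, φ k '' K k) (empty_subset _)
      fun p => ?_
    exact (image_mono inter_subset_left).trans (subset_iUnion (fun k => φ k '' K k) p.1)
  · rw [iUnion_disjointed, hQU]
    have hsub : (⋃ k, φ k '' K k) \ ⋃ p, R p ⊆ ⋃ k, φ k '' (K k \ ⋃ m, T k m) := by
      rintro z ⟨hz, hz'⟩
      obtain ⟨k, x, hx, rfl⟩ := mem_iUnion.1 hz
      refine mem_iUnion.2 ⟨k, x, ⟨hx, fun hxT => hz' ?_⟩, rfl⟩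
      obtain ⟨m, hm⟩ := mem_iUnion.1 hxT
      exact mem_iUnion.2 ⟨(k, m), x, ⟨hx, hm⟩, rfl⟩
    refine measure_mono_null hsub (measure_iUnion_null fun k => ?_)
    have h1 := normHausdorff_image_le (d := d)
      ((hφ k).mono (sdiff_subset.trans (hKG k) : K k \ ⋃ m, T k m ⊆ _)).lipschitzOnWith
    rw [normHausdorff_self, measure_mono_null (sdiff_subset_sdiff_left (hKG k)) (hT0 k),
      mul_zero] at h1
    exact le_antisymm h1 (zero_le)
  · have : ∃ g : EuclideanSpace ℝ (Fin d') → EuclideanSpace ℝ (Fin d),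
        BiLipschitzOnWith L g (Q m) := by
      refine Encodable.iUnion_decode₂_cases
        (C := fun S => ∃ g : EuclideanSpace ℝ (Fin d') → EuclideanSpace ℝ (Fin d),
          BiLipschitzOnWith L g S) ⟨fun _ => 0, fun x hx => hx.elim⟩ fun p => ?_
      exact ⟨g p.1 p.2, (hg p.1 p.2).mono (image_mono inter_subset_right)⟩
    obtain ⟨g, hg⟩ := this
    exact ⟨g, hg.mono (disjointed_subset Q m)⟩

theorem IsRectifiableManifold.exists_compact_pieces {d d' : ℕ}
    {A : Set (EuclideanSpace ℝ (Fin d'))} (hA : IsRectifiableManifold d d' A) {L : ℝ≥0}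
    (hL : 1 < L) {δ : ℝ≥0∞} (hδ : δ ≠ 0) :
    ∃ (m : ℕ) (C : Fin m → Set (EuclideanSpace ℝ (Fin d')))
      (g : Fin m → EuclideanSpace ℝ (Fin d') → EuclideanSpace ℝ (Fin d)),
      (∀ i, IsCompact (C i)) ∧ (∀ i, C i ⊆ A) ∧ Pairwise (Function.onFun Disjoint C) ∧
      normHausdorff d d' (A \ ⋃ i, C i) < δ ∧ ∀ i, BiLipschitzOnWith L (g i) (C i) := by
  obtain ⟨P, hPm, hPA, hPd, hP0, hPg⟩ := hA.exists_measurable_cover hL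
  choose g hg using hPg
  set μ := (normHausdorff d d').restrict A with hμ
  have : IsFiniteMeasure μ := ⟨by simpa [hμ] using hA.normHausdorff_lt_top⟩
  have hμA : ∀ S ⊆ A, μ S = normHausdorff d d' S := fun S hS => Measure.restrict_eq_self _ hS
  obtain ⟨ε, hε0, hεδ⟩ := ENNReal.exists_pos_sum_of_countable' hδ ℕ
  choose C hCP hCc hCμ using fun n =>
    (hPm n).exists_isCompact_sdiff_lt (measure_ne_top μ (P n)) (hε0 n).ne'
  have hlim : Tendsto (fun m => μ (A \ ⋃ i < m, C i)) atTop (𝓝 (μ (⋂ m, A \ ⋃ i < m, C i))) := by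
    refine tendsto_measure_iInter_atTop (fun m => ?_) ?_ ⟨0, measure_ne_top _ _⟩
    · exact (hA.isCompact.measurableSet.diff (MeasurableSet.iUnion fun i =>
        MeasurableSet.iUnion fun _ => (hCc i).measurableSet)).nullMeasurableSet
    · intro m m' hmm
      exact sdiff_subset_sdiff_right (biUnion_mono (fun i hi => lt_of_lt_of_le hi hmm) fun _ _ => le_rfl)
  have hsmall : μ (⋂ m, A \ ⋃ i < m, C i) < δ := by
    have hsub : (⋂ m, A \ ⋃ i < m, C i) ⊆ (A \ ⋃ n, P n) ∪ ⋃ n, P n \ C n := by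
      intro x hx
      have hxA : x ∈ A := (mem_iInter.1 hx 0).1
      by_cases hxP : x ∈ ⋃ n, P n
      · obtain ⟨n, hn⟩ := mem_iUnion.1 hxP
        refine Or.inr (mem_iUnion.2 ⟨n, hn, fun hxC => (mem_iInter.1 hx (n + 1)).2 ?_⟩)
        exact mem_iUnion₂.2 ⟨n, n.lt_succ_self, hxC⟩
      · exact Or.inl ⟨hxA, hxP⟩
    calc μ (⋂ m, A \ ⋃ i < m, C i) ≤ μ (A \ ⋃ n, P n) + μ (⋃ n, P n \ C n) :=
          (measure_mono hsub).trans (measure_union_le _ _)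
      _ ≤ 0 + ∑' n, ε n := by
          gcongr
          · rw [hμA _ sdiff_subset, hP0]
          · exact (measure_iUnion_le _).trans (ENNReal.tsum_le_tsum fun n => (hCμ n).le)
      _ < δ := by rwa [zero_add]
  obtain ⟨m, hm⟩ := (hlim.eventually_lt_const hsmall).exists
  refine ⟨m, fun i => C i, fun i => g i, fun i => hCc i, fun i => (hCP i).trans (hPA i),
    fun i j hij => (hPd (fun h => hij (Fin.ext h))).mono (hCP i) (hCP j), ?_,
    fun i => (hg i).mono (hCP i)⟩
  rw [hμA _ sdiff_subset] at hm
  convert hm using 4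
  ext x
  simp only [mem_iUnion, exists_prop]
  exact ⟨fun ⟨i, hi⟩ => ⟨i, i.2, hi⟩, fun ⟨i, hi, hx⟩ => ⟨⟨i, hi⟩, hx⟩⟩

theorem exists_pos_le_dist_of_pairwise_disjoint {X : Type*} [MetricSpace X] {m : ℕ}
    {C : Fin m → Set X} (hC : ∀ i, IsCompact (C i)) (hd : Pairwise (Function.onFun Disjoint C)) :
    ∃ a : ℝ, 0 < a ∧ a ≤ 1 ∧ ∀ i j, i ≠ j → ∀ x ∈ C i, ∀ y ∈ C j, a ≤ dist x y := by
  have h : ∀ i j, ∀ᶠ a : ℝ in 𝓝[>] 0, i ≠ j → ∀ x ∈ C i, ∀ y ∈ C j, a ≤ dist x y := by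
    intro i j
    by_cases hij : i = j
    · simp [hij]
    obtain ⟨r, hr0, hr⟩ := exists_pos_forall_lt_edist (hC i) (hC j).isClosed (hd hij)
    filter_upwards [Ioo_mem_nhdsGT (show (0 : ℝ) < r by exact_mod_cast hr0)] with a ha _ x hx y hy
    have h1 := hr x hx y hy
    rw [edist_nndist, ENNReal.coe_lt_coe] at h1
    exact (ha.2.trans (by exact_mod_cast h1 : (r : ℝ) < dist x y)).le
  have h2 := eventually_all.2 fun i => eventually_all.2 (h i)
  obtain ⟨a, ha, ha'⟩ := (h2.and (Ioo_mem_nhdsGT zero_lt_one)).exists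
  exact ⟨a, ha'.1, ha'.2.le, fun i j => ha i j⟩

theorem exists_glued_map {d d' m : ℕ} (hd : 1 ≤ d) {L : ℝ≥0}
    {C : Fin m → Set (EuclideanSpace ℝ (Fin d'))}
    {g : Fin m → EuclideanSpace ℝ (Fin d') → EuclideanSpace ℝ (Fin d)}
    (hC : ∀ i, IsCompact (C i)) (hdisj : Pairwise (Function.onFun Disjoint C))
    (hg : ∀ i, BiLipschitzOnWith L (g i) (C i)) :
    ∃ G : EuclideanSpace ℝ (Fin d') → EuclideanSpace ℝ (Fin d),
      (∀ i, BiLipschitzOnWith L G (C i)) ∧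
      ∀ i j, i ≠ j → ∀ x ∈ C i, ∀ y ∈ C j, 1 ≤ dist (G x) (G y) := by
  obtain ⟨R, hR1, hR⟩ : ∃ R : ℝ, 1 ≤ R ∧ ∀ i, ∀ x ∈ C i, ‖g i x‖ ≤ R := by
    have hb : Bornology.IsBounded (⋃ i, g i '' C i) := (isCompact_iUnion fun i =>
      (hC i).image_of_continuousOn (hg i).lipschitzOnWith.continuousOn).isBounded
    obtain ⟨R, hR⟩ := hb.exists_norm_le
    exact ⟨max 1 R, le_max_left _ _, fun i x hx =>
      (hR _ (mem_iUnion.2 ⟨i, x, hx, rfl⟩)).trans (le_max_right _ _)⟩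
  let e : EuclideanSpace ℝ (Fin d) := EuclideanSpace.single ⟨0, hd⟩ 1
  have he : ‖e‖ = 1 := by simp [e]
  let v : Fin m → EuclideanSpace ℝ (Fin d) := fun i => ((3 * R) * (i : ℝ)) • e
  have hv : ∀ i j, i ≠ j → 3 * R ≤ dist (v i) (v j) := by
    intro i j hij
    have h1 : v i - v j = ((3 * R) * ((i : ℝ) - (j : ℝ))) • e := by
      simp only [v]; rw [← sub_smul]; ring_nf
    rw [dist_eq_norm, h1, norm_smul, he, mul_one, Real.norm_eq_abs, abs_mul,
      abs_of_pos (by linarith : 0 < 3 * R)]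
    have h2 : (1 : ℝ) ≤ |(i : ℝ) - (j : ℝ)| := by
      have h3 : (1 : ℤ) ≤ |((i : ℕ) : ℤ) - ((j : ℕ) : ℤ)| := by
        apply Int.one_le_abs
        intro h
        exact hij (Fin.ext (by omega))
      exact_mod_cast h3
    nlinarith
  let G : EuclideanSpace ℝ (Fin d') → EuclideanSpace ℝ (Fin d) := fun x =>
    if h : ∃ i, x ∈ C i then g h.choose x + v h.choose else 0
  have hG : ∀ i, ∀ x ∈ C i, G x = g i x + v i := by
    intro i x hx
    have h : ∃ i, x ∈ C i := ⟨i, hx⟩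
    have hi : h.choose = i := by
      by_contra hne
      exact Set.disjoint_left.1 (hdisj hne) h.choose_spec hx
    simp only [G, dif_pos h, hi]
  refine ⟨G, fun i x hx y hy => ?_, fun i j hij x hx y hy => ?_⟩
  · rw [hG i x hx, hG i y hy, dist_add_right]
    exact hg i x hx y hy
  · rw [hG i x hx, hG j y hy]
    have h1 := hv i j hij
    have h2 := hR i x hx
    have h3 := hR j y hy
    rw [dist_eq_norm] at h1 ⊢
    have h4 : v i - v j = (g i x + v i - (g j y + v j)) - g i x + g j y := by abel
    have h5 : ‖v i - v j‖ ≤ ‖g i x + v i - (g j y + v j)‖ + ‖g i x‖ + ‖g j y‖ := by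
      rw [h4]
      exact (norm_add_le _ _).trans (by gcongr; exact norm_sub_le _ _)
    linarith

/-- Up to small Hausdorff measure, a rectifiable manifold is a compact set which is mapped by a
locally almost isometric injection onto a compact subset of `ℝ^d`. -/
theorem IsRectifiableManifold.exists_almost_isometric_compact {d d' : ℕ} (hd : 1 ≤ d)
    {A : Set (EuclideanSpace ℝ (Fin d'))} (hA : IsRectifiableManifold d d' A) {L : ℝ≥0}
    (hL : 1 < L) {δ : ℝ≥0∞} (hδ : δ ≠ 0) :
    ∃ (C : Set (EuclideanSpace ℝ (Fin d')))
      (G : EuclideanSpace ℝ (Fin d') → EuclideanSpace ℝ (Fin d)) (a : ℝ),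
      IsCompact C ∧ C ⊆ A ∧ 0 < a ∧ normHausdorff d d' (A \ C) < δ ∧ IsCompact (G '' C) ∧
      volume (G '' C) ≤ (L : ℝ≥0∞) ^ d * normHausdorff d d' C ∧
      normHausdorff d d' C ≤ (L : ℝ≥0∞) ^ d * volume (G '' C) ∧
      (∀ x ∈ C, ∀ y ∈ C, dist (G x) (G y) ≤ L * dist x y ∨ a ≤ dist x y) ∧
      ∀ x ∈ C, ∀ y ∈ C, dist x y ≤ L * dist (G x) (G y) ∨ a ≤ dist (G x) (G y) := by
  obtain ⟨m, C, g, hC, hCA, hdisj, hAC, hg⟩ := hA.exists_compact_pieces hL hδ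
  obtain ⟨a, ha0, ha1, ha⟩ := exists_pos_le_dist_of_pairwise_disjoint hC hdisj
  obtain ⟨G, hGbi, hGd⟩ := exists_glued_map hd hC hdisj hg
  have hGC : ∀ i, IsCompact (G '' C i) := fun i =>
    (hC i).image_of_continuousOn (hGbi i).lipschitzOnWith.continuousOn
  have hGdisj : Pairwise (Function.onFun Disjoint fun i => G '' C i) := by
    intro i j hij
    rw [Function.onFun, Set.disjoint_left]
    rintro _ ⟨x, hx, rfl⟩ ⟨y, hy, hxy⟩
    have := hGd i j hij x hx y hy
    rw [hxy, dist_self] at this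
    linarith
  have hvol : volume (G '' ⋃ i, C i) = ∑ i, volume (G '' C i) := by
    rw [image_iUnion, measure_iUnion hGdisj fun i => (hGC i).measurableSet, tsum_fintype]
  have hH : normHausdorff d d' (⋃ i, C i) = ∑ i, normHausdorff d d' (C i) := by
    rw [measure_iUnion hdisj fun i => (hC i).measurableSet, tsum_fintype]
  refine ⟨⋃ i, C i, G, a, isCompact_iUnion hC, iUnion_subset hCA, ha0, hAC, ?_, ?_, ?_, ?_, ?_⟩
  · rw [image_iUnion]
    exact isCompact_iUnion hGC
  · rw [hvol, hH, Finset.mul_sum]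
    refine Finset.sum_le_sum fun i _ => ?_
    rw [← normHausdorff_self]
    exact normHausdorff_image_le (hGbi i).lipschitzOnWith
  · rw [hvol, hH, Finset.mul_sum]
    refine Finset.sum_le_sum fun i _ => ?_
    have hinv := (hGbi i).injOn.leftInvOn_invFunOn
    have h1 := normHausdorff_image_le (d := d)
      ((hGbi i).of_leftInvOn hinv).lipschitzOnWith
    rwa [hinv.image_image, normHausdorff_self] at h1
  · intro x hx y hy
    obtain ⟨i, hi⟩ := mem_iUnion.1 hx
    obtain ⟨j, hj⟩ := mem_iUnion.1 hy
    by_cases hij : i = j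
    · subst hij
      exact Or.inl (hGbi i x hi y hj).1
    · exact Or.inr (ha i j hij x hi y hj)
  · intro x hx y hy
    obtain ⟨i, hi⟩ := mem_iUnion.1 hx
    obtain ⟨j, hj⟩ := mem_iUnion.1 hy
    by_cases hij : i = j
    · subst hij
      exact Or.inl (hGbi i x hi y hj).2
    · exact Or.inr (ha1.trans (hGd i j hij x hi y hj))

theorem card_filter_near_mul_le_rieszEnergy {E : Type*} [MetricSpace E] {s : ℝ} (hs : 0 ≤ s)
    (ω : Finset E) (ρ : ℝ) :
    ((ω.filter fun x => ∃ y ∈ ω, x ≠ y ∧ dist x y < ρ).card : ℝ≥0∞) * ENNReal.ofReal (ρ ^ (-s)) ≤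
      rieszEnergy s ω := by
  rw [← nsmul_eq_mul, ← Finset.sum_const]
  refine (Finset.sum_le_sum fun x hx => ?_).trans
    (Finset.sum_le_sum_of_subset (Finset.filter_subset _ _))
  obtain ⟨-, y, hy, hxy, hlt⟩ := Finset.mem_filter.1 hx
  refine le_trans ?_ (Finset.single_le_sum
    (f := fun y => if x = y then (0 : ℝ≥0∞) else edist x y ^ (-s)) (fun _ _ => zero_le) hy)
  simp only [if_neg hxy]
  have hd : 0 < dist x y := dist_pos.2 hxy
  rw [edist_dist, ENNReal.ofReal_rpow_of_pos hd]
  exact ENNReal.ofReal_le_ofReal (Real.rpow_le_rpow_of_nonpos hd hlt.le (by linarith))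

theorem card_mul_volume_ball_add_le {d : ℕ} {ι : Type*} (S : Finset ι)
    (u : ι → EuclideanSpace ℝ (Fin d)) {K C : Set (EuclideanSpace ℝ (Fin d))}
    (hCK : C ⊆ K) {h : ℝ} (hh : 0 < h) (hu : ∀ i ∈ S, u i ∈ K)
    (hsep : ∀ i ∈ S, ∀ j ∈ S, i ≠ j → 2 * h ≤ dist (u i) (u j))
    (hfar : ∀ i ∈ S, ∀ z ∈ C, h < dist (u i) z) :
    (S.card : ℝ≥0∞) * (ENNReal.ofReal (h ^ d) *
      volume (ball (0 : EuclideanSpace ℝ (Fin d)) 1)) + volume C ≤ volume (cthickening h K) := by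
  have hball : volume (⋃ i ∈ S, ball (u i) h) =
      S.card * (ENNReal.ofReal (h ^ d) * volume (ball (0 : EuclideanSpace ℝ (Fin d)) 1)) := by
    rw [measure_biUnion_finset _ fun i _ => measurableSet_ball]
    · simp_rw [Measure.addHaar_ball_of_pos volume _ hh, finrank_euclideanSpace_fin]
      rw [Finset.sum_const, nsmul_eq_mul]
    · intro i hi j hj hij
      exact ball_disjoint_ball (by linarith [hsep i hi j hj hij])
  rw [← hball, ← measure_union' _ (Finset.measurableSet_biUnion S fun i _ => measurableSet_ball)]
  · refine measure_mono (union_subset (iUnion₂_subset fun i hi => ?_) (hCK.trans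
      (self_subset_cthickening K)))
    exact ball_subset_closedBall.trans (closedBall_subset_cthickening (hu i hi) h)
  · rw [Set.disjoint_left]
    intro z hz hzC
    obtain ⟨i, hi, hzi⟩ := mem_iUnion₂.1 hz
    have := hfar i hi z hzC
    rw [mem_ball, dist_comm] at hzi
    linarith

/-- Low energy configurations on `A` can, after discarding a small proportion of the points, be
moved into a compact subset of almost full measure without much decrease of distances. -/
theorem IsRectifiableManifold.exists_perturbation {d d' : ℕ} (hd : 1 ≤ d)
    {A : Set (EuclideanSpace ℝ (Fin d'))} (hA : IsRectifiableManifold d d' A) {s : ℝ} (hs : 0 < s)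
    {L η b : ℝ} (hL : 1 < L) (hη : 0 < η) (hb : 0 < b) :
    ∃ δ : ℝ≥0∞, δ ≠ 0 ∧ ∀ C ⊆ A, IsCompact C → normHausdorff d d' (A \ C) < δ →
      ∀ᶠ N : ℕ in atTop, ∀ ω : Finset (EuclideanSpace ℝ (Fin d')), ↑ω ⊆ A → ω.card = N →
        rieszEnergy s ω ≤ ENNReal.ofReal (b * (N : ℝ) ^ (1 + s / (d : ℝ))) →
        ∃ ω' ⊆ ω, ω'.card = ⌈(1 - η) * N⌉₊ ∧
          ∃ f : EuclideanSpace ℝ (Fin d') → EuclideanSpace ℝ (Fin d'),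
            (∀ x ∈ ω', f x ∈ C) ∧ ∀ x ∈ ω', ∀ y ∈ ω', dist x y ≤ L * dist (f x) (f y) := by
  obtain ⟨n, K, G, φ, L₀, hL₀, hK, -, hKG, hφ, hAeq⟩ := hA.exists_charts
  replace hφ : ∀ k, BiLipschitzOnWith L₀ (φ k) (K k) := fun k => (hφ k).mono (hKG k)
  have hL₀r : (1 : ℝ) ≤ L₀ := by exact_mod_cast hL₀
  have hd0 : (0 : ℝ) < d := by exact_mod_cast hd
  have hLinv : 0 < 1 - L⁻¹ := sub_pos.2 (inv_lt_one_of_one_lt₀ hL)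
  set c : ℝ := (η / (2 * b)) ^ (1 / s) with hc
  have hc0 : 0 < c := by positivity
  have hcs : b * c ^ s = η / 2 := by
    rw [hc, ← Real.rpow_mul (by positivity), one_div_mul_cancel hs.ne', Real.rpow_one]
    field_simp
  set τ : ℝ := c * (1 - L⁻¹) / (2 * L₀) with hτ
  have hτ0 : 0 < τ := by positivity
  have hτL : 2 * L₀ * τ = c * (1 - L⁻¹) := by rw [hτ]; field_simp
  have hτc : L₀ * (2 * τ) ≤ c := by
    have : 0 < L⁻¹ := by positivity
    nlinarith
  set V := volume (ball (0 : EuclideanSpace ℝ (Fin d)) 1) with hV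
  have hVtop : V ≠ ∞ := measure_ball_lt_top.ne
  have hV0 : 0 < V.toReal := ENNReal.toReal_pos (measure_ball_pos _ _ one_pos).ne' hVtop
  set ν : ℝ := η * V.toReal * τ ^ d / (2 * (n + 1)) with hν
  have hν0 : 0 < ν := by positivity
  have hL₀d : (L₀ : ℝ≥0∞) ^ d ≠ 0 :=
    pow_ne_zero _ (by exact_mod_cast (zero_lt_one.trans_le hL₀).ne')
  have hL₀d' : (L₀ : ℝ≥0∞) ^ d ≠ ∞ := ENNReal.pow_ne_top ENNReal.coe_ne_top
  refine ⟨ENNReal.ofReal ν / (L₀ : ℝ≥0∞) ^ d,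
    ENNReal.div_ne_zero.2 ⟨by simpa using hν0, hL₀d'⟩, fun C hCA hC hAC => ?_⟩
  set D : Fin n → Set (EuclideanSpace ℝ (Fin d)) := fun k => K k ∩ φ k ⁻¹' C with hD
  have hDc : ∀ k, IsCompact (D k) := fun k =>
    (hK k).of_isClosed_subset ((hφ k).lipschitzOnWith.continuousOn.preimage_isClosed_of_isClosed
      (hK k).isClosed hC.isClosed) inter_subset_left
  have hKD : ∀ k, volume (K k) < volume (D k) + ENNReal.ofReal ν := by
    intro k
    have h1 : volume (K k \ D k) < ENNReal.ofReal ν := by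
      have hbi := (hφ k).mono (sdiff_subset : K k \ D k ⊆ K k)
      have hinv := hbi.injOn.leftInvOn_invFunOn
      have h2 := normHausdorff_image_le (d := d) (hbi.of_leftInvOn hinv).lipschitzOnWith
      rw [hinv.image_image, normHausdorff_self] at h2
      have h3 : φ k '' (K k \ D k) ⊆ A \ C := by
        rintro _ ⟨x, ⟨hx, hxD⟩, rfl⟩
        refine ⟨?_, fun hxC => hxD ⟨hx, hxC⟩⟩
        rw [hAeq]
        exact mem_iUnion.2 ⟨k, x, hx, rfl⟩
      have h4 := (measure_mono h3).trans_lt hAC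
      rw [ENNReal.lt_div_iff_mul_lt (Or.inl hL₀d) (Or.inl hL₀d')] at h4
      exact h2.trans_lt (by rwa [mul_comm])
    calc volume (K k) ≤ volume (D k) + volume (K k \ D k) := by
          rw [← measure_union disjoint_sdiff_right ((hK k).measurableSet.diff (hDc k).measurableSet)]
          exact measure_mono (by rw [union_sdiff_self]; exact subset_union_right)
      _ < _ := ENNReal.add_lt_add_left (hDc k).measure_lt_top.ne h1
  have hr : Tendsto (fun N : ℕ => τ * (N : ℝ) ^ (-(1 / (d : ℝ)))) atTop (𝓝 0) := by
    have := ((tendsto_rpow_neg_atTop (one_div_pos.2 hd0)).comp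
      tendsto_natCast_atTop_atTop).const_mul τ
    simpa using this
  have hthick : ∀ᶠ N : ℕ in atTop, ∀ k,
      volume (cthickening (τ * (N : ℝ) ^ (-(1 / (d : ℝ)))) (K k)) <
        volume (D k) + ENNReal.ofReal ν :=
    eventually_all.2 fun k => ((tendsto_measure_cthickening_of_isCompact (μ := volume)
      (hK k)).comp hr).eventually_lt_const (hKD k)
  filter_upwards [hthick, eventually_gt_atTop 0] with N hN hN0 ω hωA hωN hE
  have hNr : (0 : ℝ) < N := by exact_mod_cast hN0
  set r : ℝ := (N : ℝ) ^ (-(1 / (d : ℝ))) with hrdef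
  have hr0 : 0 < r := by positivity
  set h : ℝ := τ * r with hh
  have hh0 : 0 < h := by positivity
  set bad := ω.filter fun x => ∃ y ∈ ω, x ≠ y ∧ dist x y < c * r with hbad
  have hbadcard : (bad.card : ℝ) ≤ η / 2 * N := by
    have h1 : (bad.card : ℝ≥0∞) * ENNReal.ofReal ((c * r) ^ (-s)) ≤
        ENNReal.ofReal (b * (N : ℝ) ^ (1 + s / (d : ℝ))) := by
      refine (le_of_eq ?_).trans ((card_filter_near_mul_le_rieszEnergy hs.le ω (c * r)).trans hE)
      congr!
    rw [← ENNReal.ofReal_natCast, ← ENNReal.ofReal_mul (by positivity),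
      ENNReal.ofReal_le_ofReal_iff (by positivity)] at h1
    have h2 : (c * r) ^ (-s) = (c ^ s)⁻¹ * (N : ℝ) ^ (s / (d : ℝ)) := by
      rw [Real.mul_rpow hc0.le hr0.le, Real.rpow_neg hc0.le, hrdef, ← Real.rpow_mul hNr.le]
      congr 2
      ring
    rw [h2, Real.rpow_add hNr, Real.rpow_one, ← mul_assoc, ← mul_assoc] at h1
    have h3 := le_of_mul_le_mul_right h1 (by positivity)
    rw [← div_eq_mul_inv, div_le_iff₀ (by positivity)] at h3
    calc (bad.card : ℝ) ≤ b * N * c ^ s := h3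
      _ = η / 2 * N := by rw [← hcs]; ring
  have hsep : ∀ x ∈ ω \ bad, ∀ y ∈ ω \ bad, x ≠ y → c * r ≤ dist x y := by
    intro x hx y hy hxy
    by_contra hlt
    rw [Finset.mem_sdiff] at hx hy
    exact hx.2 (Finset.mem_filter.2 ⟨hx.1, y, hy.1, hxy, not_le.1 hlt⟩)
  set far : Fin n → Finset (EuclideanSpace ℝ (Fin d')) := fun k =>
    (ω \ bad).filter fun x => ∃ p ∈ K k, φ k p = x ∧ ∀ z ∈ D k, h < dist p z with hfar
  have hfarcard : ∀ k, ((far k).card : ℝ) ≤ η / (2 * (n + 1)) * N := by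
    intro k
    have hex : ∀ x ∈ far k, ∃ p ∈ K k, φ k p = x ∧ ∀ z ∈ D k, h < dist p z := fun x hx =>
      (Finset.mem_filter.1 hx).2
    choose! u huK hφu hud using hex
    have h1 := card_mul_volume_ball_add_le (far k) u
      (inter_subset_left : D k ⊆ K k) hh0 huK (fun x hx y hy hxy => by
        have h2 := hsep x (Finset.mem_filter.1 hx).1 y (Finset.mem_filter.1 hy).1 hxy
        have h3 := (hφ k _ (huK x hx) _ (huK y hy)).1
        rw [hφu x hx, hφu y hy] at h3
        have h4 : L₀ * (2 * h) ≤ L₀ * dist (u x) (u y) := by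
          refine le_trans ?_ (h2.trans h3)
          rw [hh]
          nlinarith
        exact le_of_mul_le_mul_left h4 (by linarith)) hud
    have h2 := h1.trans (hN k).le
    rw [add_comm, ENNReal.add_le_add_iff_left (hDc k).measure_lt_top.ne, ← hV,
      ← ENNReal.ofReal_toReal hVtop, ← ENNReal.ofReal_natCast, ← ENNReal.ofReal_mul (by positivity),
      ← ENNReal.ofReal_mul (by positivity), ENNReal.ofReal_le_ofReal_iff hν0.le] at h2
    have h3 : h ^ d = τ ^ d * (N : ℝ)⁻¹ := by
      rw [hh, mul_pow, hrdef, ← Real.rpow_natCast (_ ^ _) d, ← Real.rpow_mul hNr.le,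
        neg_mul, one_div_mul_cancel hd0.ne', Real.rpow_neg_one]
    rw [h3, hν] at h2
    have hP : 0 < V.toReal * τ ^ d * (N : ℝ)⁻¹ := by positivity
    refine le_of_mul_le_mul_right ?_ hP
    calc (far k).card * (V.toReal * τ ^ d * (N : ℝ)⁻¹)
        = (far k).card * (τ ^ d * (N : ℝ)⁻¹ * V.toReal) := by ring
      _ ≤ _ := h2
      _ = η / (2 * (n + 1)) * N * (V.toReal * τ ^ d * (N : ℝ)⁻¹) := by field_simp
  set good := (ω \ bad) \ Finset.univ.biUnion far with hgood
  have hgoodcard : ⌈(1 - η) * N⌉₊ ≤ good.card := by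
    rw [Nat.ceil_le]
    have h1 : (ω.card : ℝ) ≤ good.card + bad.card + ∑ k, ((far k).card : ℝ) := by
      have h2 := Finset.card_le_card_sdiff_add_card (s := ω) (t := bad)
      have h3 := Finset.card_le_card_sdiff_add_card (s := ω \ bad) (t := Finset.univ.biUnion far)
      have h4 := Finset.card_biUnion_le (s := Finset.univ) (t := far)
      rw [← hgood] at h3
      have : ω.card ≤ good.card + bad.card + ∑ k, (far k).card := by omega
      exact_mod_cast this
    have h2 : ∑ k, ((far k).card : ℝ) ≤ η / 2 * N := by
      calc ∑ k, ((far k).card : ℝ) ≤ ∑ _k : Fin n, η / (2 * (n + 1)) * N :=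
            Finset.sum_le_sum fun k _ => hfarcard k
        _ = (n / (n + 1)) * (η / 2 * N) := by
            rw [Finset.sum_const, Finset.card_univ, Fintype.card_fin, nsmul_eq_mul]
            field_simp
        _ ≤ 1 * (η / 2 * N) := by
            gcongr
            rw [div_le_one (by positivity)]
            linarith
        _ = _ := one_mul _
    rw [hωN] at h1
    linarith
  obtain ⟨ω', hω', hcard⟩ := Finset.exists_subset_card_eq hgoodcard
  have hgoodsub : good ⊆ ω \ bad := Finset.sdiff_subset
  have hnear : ∀ x ∈ ω', ∃ w ∈ C, dist x w ≤ L₀ * h := by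
    intro x hx
    have hxg := hω' hx
    have hxA : x ∈ A := hωA (Finset.mem_sdiff.1 (hgoodsub hxg)).1
    rw [hAeq] at hxA
    obtain ⟨k, p, hp, rfl⟩ := mem_iUnion.1 hxA
    have hnot : φ k p ∉ far k := fun hf =>
      (Finset.mem_sdiff.1 hxg).2 (Finset.mem_biUnion.2 ⟨k, Finset.mem_univ _, hf⟩)
    by_contra! hcon
    refine hnot (Finset.mem_filter.2 ⟨hgoodsub hxg, p, hp, rfl, fun z hz => ?_⟩)
    have h1 := hcon (φ k z) hz.2
    have h2 := (hφ k p hp z hz.1).1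
    exact lt_of_mul_lt_mul_left (h1.trans_le h2) (by positivity)
  choose! f hfC hfd using hnear
  refine ⟨ω', hω'.trans (hgoodsub.trans Finset.sdiff_subset), hcard, f, hfC, fun x hx y hy => ?_⟩
  by_cases hxy : x = y
  · simp [hxy]
  have h1 := hsep x (hgoodsub (hω' hx)) y (hgoodsub (hω' hy)) hxy
  have h2 : dist x y ≤ dist x (f x) + dist (f x) (f y) + dist (f y) y := dist_triangle4 _ _ _ _
  have h3 := hfd x hx
  have h4 := hfd y hy
  rw [dist_comm] at h4
  have h5 : 2 * (L₀ * h) = c * r * (1 - L⁻¹) := by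
    calc 2 * (L₀ * h) = 2 * L₀ * τ * r := by rw [hh]; ring
      _ = _ := by rw [hτL]; ring
  have h6 : c * r * (1 - L⁻¹) ≤ dist x y * (1 - L⁻¹) := by gcongr
  have h7 : L⁻¹ * dist x y ≤ dist (f x) (f y) := by linarith
  rwa [inv_mul_le_iff₀ (by linarith)] at h7

theorem minRieszEnergy_le_of_mapsTo {E F : Type*} [MetricSpace E] [MetricSpace F] {s : ℝ}
    (hs : 0 ≤ s) {A : Set E} {B : Set F} {f : E → F} (hB : MapsTo f A B) {L a : ℝ} (hL : 0 < L)
    (ha : 0 < a) (hf : ∀ x ∈ A, ∀ y ∈ A, dist x y ≤ L * dist (f x) (f y) ∨ a ≤ dist (f x) (f y))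
    (N : ℕ) :
    minRieszEnergy s B N ≤ ENNReal.ofReal (L ^ s) * minRieszEnergy s A N +
      ENNReal.ofReal (a ^ (-s)) * (N : ℝ≥0∞) ^ 2 := by
  have hc0 : ENNReal.ofReal (L ^ s) ≠ 0 := by
    rw [Ne, ENNReal.ofReal_eq_zero, not_le]; positivity
  rw [← tsub_le_iff_right, mul_comm (ENNReal.ofReal (L ^ s)), ← ENNReal.div_le_iff_le_mul (Or.inl hc0)
    (Or.inl ENNReal.ofReal_ne_top)]
  refine le_iInf fun ω => le_iInf fun hω => le_iInf fun hN => ?_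
  rw [ENNReal.div_le_iff_le_mul (Or.inl hc0) (Or.inl ENNReal.ofReal_ne_top), tsub_le_iff_right,
    mul_comm (rieszEnergy s ω), ← hN]
  exact minRieszEnergy_card_le hs (fun x hx => hB (hω hx)) hL ha
    fun x hx y hy => hf x (hω hx) y (hω hy)

theorem ENNReal.div_rpow_le_of_le_mul {u v c : ℝ≥0∞} (w : ℝ≥0∞) {q : ℝ} (hq : 0 ≤ q)
    (hc : c ≠ 0) (hc' : c ≠ ∞) (h : u ≤ c * v) : w / v ^ q ≤ c ^ q * (w / u ^ q) := by
  have h1 : u ^ q ≤ c ^ q * v ^ q := by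
    rw [← ENNReal.mul_rpow_of_nonneg _ _ hq]
    exact ENNReal.rpow_le_rpow h hq
  have hcq : c ^ q ≠ 0 := (ENNReal.rpow_pos (pos_iff_ne_zero.2 hc) hc').ne'
  have hcq' : c ^ q ≠ ∞ := ENNReal.rpow_ne_top_of_nonneg hq hc'
  have h2 : (v ^ q)⁻¹ ≤ c ^ q * (u ^ q)⁻¹ := by
    calc (v ^ q)⁻¹ = c ^ q * (c ^ q * v ^ q)⁻¹ := by
          rw [ENNReal.mul_inv (Or.inl hcq) (Or.inl hcq'), ← mul_assoc,
            ENNReal.mul_inv_cancel hcq hcq', one_mul]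
      _ ≤ _ := by gcongr
  rw [div_eq_mul_inv, div_eq_mul_inv, mul_left_comm]
  gcongr

theorem ENNReal.exists_one_lt_rpow_mul_lt {x y : ℝ≥0∞} (h : x < y) (e : ℝ) :
    ∃ L : ℝ≥0, 1 < L ∧ (L : ℝ≥0∞) ^ e * x < y := by
  have hx : x ≠ ∞ := (h.trans_le le_top).ne
  have h1 : Tendsto (fun L : ℝ≥0 => (L : ℝ≥0∞) ^ e * x) (𝓝[>] 1) (𝓝 x) := by
    have h2 : Tendsto (fun L : ℝ≥0 => (L : ℝ≥0∞) ^ e * x) (𝓝[>] 1) (𝓝 (((1 : ℝ≥0) : ℝ≥0∞) ^ e * x)) :=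
      (ENNReal.Tendsto.mul_const (((ENNReal.continuous_rpow_const.comp
        ENNReal.continuous_coe).tendsto 1).mono_left nhdsWithin_le_nhds) (Or.inr hx))
    simpa using h2
  obtain ⟨L, hL, hL1⟩ := ((h1.eventually_lt_const h).and self_mem_nhdsWithin).exists
  exact ⟨L, hL1, hL⟩

theorem tendsto_sq_div_rpow {p : ℝ} (hp : 2 < p) :
    Tendsto (fun N : ℕ => (N : ℝ≥0∞) ^ 2 / ENNReal.ofReal ((N : ℝ) ^ p)) atTop (𝓝 0) := by
  have h1 : Tendsto (fun N : ℕ => ENNReal.ofReal ((N : ℝ) ^ (-(p - 2)))) atTop (𝓝 0) := by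
    have h2 := ENNReal.tendsto_ofReal ((tendsto_rpow_neg_atTop (sub_pos.2 hp)).comp
      tendsto_natCast_atTop_atTop)
    simpa using h2
  refine h1.congr' ?_
  filter_upwards [eventually_gt_atTop 0] with N hN
  have hN' : (0 : ℝ) < N := by exact_mod_cast hN
  rw [← ENNReal.ofReal_natCast, ← ENNReal.ofReal_pow hN'.le,
    ← ENNReal.ofReal_div_of_pos (by positivity), neg_sub, Real.rpow_sub hN', Real.rpow_two]

/-- The normalized minimal energy of `A` is eventually below any bound exceeding the limit. -/
theorem IsRectifiableManifold.eventually_minRieszEnergy_div_lt {d d' : ℕ} (hd : 1 ≤ d) {s : ℝ}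
    (hs : (d : ℝ) < s) {A : Set (EuclideanSpace ℝ (Fin d'))} (hA : IsRectifiableManifold d d' A)
    {w : ℝ≥0∞} (hw0 : w ≠ 0)
    (hlim : ∀ K : Set (EuclideanSpace ℝ (Fin d)), IsCompact K →
      Tendsto
        (fun N : ℕ => minRieszEnergy s K N / ENNReal.ofReal ((N : ℝ) ^ (1 + s / (d : ℝ))))
        atTop (𝓝 (w / (volume K) ^ (s / (d : ℝ)))))
    {b : ℝ≥0∞} (hb : w / (normHausdorff d d' A) ^ (s / (d : ℝ)) < b) :
    ∀ᶠ N : ℕ in atTop,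
      minRieszEnergy s A N / ENNReal.ofReal ((N : ℝ) ^ (1 + s / (d : ℝ))) < b := by
  have hd0 : (0 : ℝ) < d := by exact_mod_cast hd
  have hs0 : 0 < s := hd0.trans hs
  set q := s / (d : ℝ) with hq
  have hq1 : 1 < q := (one_lt_div hd0).2 hs
  have hHtop := hA.normHausdorff_lt_top.ne
  set H := normHausdorff d d' A with hH
  have hH0 : H ≠ 0 := by
    intro h0
    rw [h0, ENNReal.zero_rpow_of_pos (by linarith), ENNReal.div_zero hw0] at hb
    exact absurd hb not_top_lt
  obtain ⟨L, hL, hLb⟩ := ENNReal.exists_one_lt_rpow_mul_lt hb (s + (d + 1) * q)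
  have hL0 : 0 < L := zero_lt_one.trans hL
  have hLne : (L : ℝ≥0∞) ≠ 0 := by exact_mod_cast hL0.ne'
  have hinv : L⁻¹ < 1 := inv_lt_one_of_one_lt₀ hL
  have hδ : ((1 - L⁻¹ : ℝ≥0) : ℝ≥0∞) * H ≠ 0 :=
    mul_ne_zero (by exact_mod_cast (tsub_pos_of_lt hinv).ne') hH0
  obtain ⟨C, G, a, hC, hCA, ha, hAC, hGC, -, hvol, hG, -⟩ :=
    hA.exists_almost_isometric_compact hd hL hδ
  have hHC : H ≤ L * normHausdorff d d' C := by
    have h1 : H ≤ normHausdorff d d' C + ((1 - L⁻¹ : ℝ≥0) : ℝ≥0∞) * H := by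
      calc H ≤ normHausdorff d d' (C ∪ A \ C) :=
            measure_mono (by rw [union_sdiff_self]; exact subset_union_right)
        _ ≤ _ := (measure_union_le _ _).trans (by gcongr)
    have h2 : ((L⁻¹ : ℝ≥0) : ℝ≥0∞) * H + ((1 - L⁻¹ : ℝ≥0) : ℝ≥0∞) * H = H := by
      rw [← add_mul, ← ENNReal.coe_add, add_tsub_cancel_of_le hinv.le, ENNReal.coe_one, one_mul]
    conv_lhs at h1 => rw [← h2]
    rw [ENNReal.add_le_add_iff_right (ENNReal.mul_ne_top ENNReal.coe_ne_top hHtop)] at h1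
    calc H = L * (((L⁻¹ : ℝ≥0) : ℝ≥0∞) * H) := by
          rw [← mul_assoc, ← ENNReal.coe_mul, mul_inv_cancel₀ hL0.ne', ENNReal.coe_one, one_mul]
      _ ≤ _ := by gcongr
  have hHvol : H ≤ (L : ℝ≥0∞) ^ (d + 1) * volume (G '' C) := by
    calc H ≤ L * normHausdorff d d' C := hHC
      _ ≤ L * ((L : ℝ≥0∞) ^ d * volume (G '' C)) := by gcongr
      _ = _ := by ring
  have hT := ENNReal.div_rpow_le_of_le_mul w (by linarith : 0 ≤ q)
    (pow_ne_zero (d + 1) hLne) (ENNReal.pow_ne_top ENNReal.coe_ne_top) hHvol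
  have hlt : (L : ℝ≥0∞) ^ s * (w / volume (G '' C) ^ q) + ENNReal.ofReal (a ^ (-s)) * 0 < b := by
    rw [mul_zero, add_zero]
    refine lt_of_le_of_lt ?_ hLb
    rw [ENNReal.rpow_add _ _ hLne ENNReal.coe_ne_top, mul_assoc, ENNReal.rpow_mul]
    gcongr
    simpa [← ENNReal.rpow_natCast] using hT
  have hmaps : MapsTo (Function.invFunOn G C) (G '' C) C := fun u hu =>
    Function.invFunOn_mem hu
  have hright : ∀ u ∈ G '' C, G (Function.invFunOn G C u) = u := fun u hu =>
    Function.invFunOn_eq hu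
  have hE := minRieszEnergy_le_of_mapsTo hs0.le hmaps (L := L) (a := a) (by exact_mod_cast hL0) ha
    (fun u hu v hv => by
      have h := hG _ (hmaps hu) _ (hmaps hv)
      rwa [hright u hu, hright v hv] at h)
  have hLs : ENNReal.ofReal ((L : ℝ) ^ s) = (L : ℝ≥0∞) ^ s := by
    rw [← ENNReal.ofReal_rpow_of_pos (by exact_mod_cast hL0), ENNReal.ofReal_coe_nnreal]
  rw [hLs] at hE
  have hlim' := (ENNReal.Tendsto.const_mul (hlim _ hGC) (a := (L : ℝ≥0∞) ^ s)
    (Or.inr (ENNReal.rpow_ne_top_of_nonneg hs0.le ENNReal.coe_ne_top))).add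
    (ENNReal.Tendsto.const_mul (tendsto_sq_div_rpow (by linarith : 2 < 1 + q))
      (a := ENNReal.ofReal (a ^ (-s))) (Or.inr ENNReal.ofReal_ne_top))
  filter_upwards [hlim'.eventually_lt_const hlt] with N hN
  refine lt_of_le_of_lt ?_ hN
  calc _ ≤ ((L : ℝ≥0∞) ^ s * minRieszEnergy s (G '' C) N +
        ENNReal.ofReal (a ^ (-s)) * (N : ℝ≥0∞) ^ 2) / ENNReal.ofReal ((N : ℝ) ^ (1 + q)) := by
        gcongr
        exact (minRieszEnergy_anti s hCA N).trans (hE N)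
    _ = _ := by rw [ENNReal.add_div, mul_div_assoc, mul_div_assoc]

/-- The normalized minimal energy of `A` is eventually above any bound less than the limit. -/
theorem IsRectifiableManifold.eventually_lt_minRieszEnergy_div {d d' : ℕ} (hd : 1 ≤ d) {s : ℝ}
    (hs : (d : ℝ) < s) {A : Set (EuclideanSpace ℝ (Fin d'))} (hA : IsRectifiableManifold d d' A)
    {w : ℝ≥0∞}
    (hlim : ∀ K : Set (EuclideanSpace ℝ (Fin d)), IsCompact K →
      Tendsto
        (fun N : ℕ => minRieszEnergy s K N / ENNReal.ofReal ((N : ℝ) ^ (1 + s / (d : ℝ))))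
        atTop (𝓝 (w / (volume K) ^ (s / (d : ℝ)))))
    {b : ℝ≥0∞} (hb : b < w / (normHausdorff d d' A) ^ (s / (d : ℝ))) :
    ∀ᶠ N : ℕ in atTop,
      b < minRieszEnergy s A N / ENNReal.ofReal ((N : ℝ) ^ (1 + s / (d : ℝ))) := by
  have hd0 : (0 : ℝ) < d := by exact_mod_cast hd
  have hs0 : 0 < s := hd0.trans hs
  set q := s / (d : ℝ) with hq
  have hq1 : 1 < q := (one_lt_div hd0).2 hs
  obtain ⟨β, hbβ, hβ⟩ := ENNReal.lt_iff_exists_nnreal_btwn.1 hb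
  have hβ0 : 0 < (β : ℝ) := by
    have : 0 < β := by exact_mod_cast (zero_le.trans_lt hbβ)
    exact_mod_cast this
  obtain ⟨L, hL, hLβ⟩ := ENNReal.exists_one_lt_rpow_mul_lt hβ (d * q + (2 * s + (1 + q)))
  have hL0 : 0 < L := zero_lt_one.trans hL
  have hLr : (1 : ℝ) < L := by exact_mod_cast hL
  have hLr0 : (0 : ℝ) < L := by exact_mod_cast hL0
  have hLne : (L : ℝ≥0∞) ≠ 0 := by exact_mod_cast hL0.ne'
  have hη : 0 < 1 - (L : ℝ)⁻¹ := sub_pos.2 (inv_lt_one_of_one_lt₀ hLr)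
  obtain ⟨δ, hδ, hpert⟩ := hA.exists_perturbation hd hs0 hLr hη hβ0
  obtain ⟨C, G, a, hC, hCA, ha, hAC, hGC, hvol, -, -, hG⟩ :=
    hA.exists_almost_isometric_compact hd hL hδ
  have hpert := hpert C hCA hC hAC
  rw [sub_sub_cancel] at hpert
  by_contra hcon
  have hfreq : ∃ᶠ N : ℕ in atTop,
      minRieszEnergy s A N / ENNReal.ofReal ((N : ℝ) ^ (1 + q)) < β :=
    (not_eventually.1 hcon).mono fun N hN => (not_lt.1 hN).trans_lt hbβ
  set M : ℕ → ℕ := fun N => ⌈(L : ℝ)⁻¹ * N⌉₊ with hM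
  have hMtop : Tendsto M atTop atTop :=
    tendsto_nat_ceil_atTop.comp
      (tendsto_natCast_atTop_atTop.const_mul_atTop (inv_pos.2 hLr0))
  have hl := (hlim _ hGC).comp hMtop
  have hr : Tendsto (fun N => (L : ℝ≥0∞) ^ (2 * s + (1 + q)) * β + ENNReal.ofReal (a ^ (-s)) *
      (((M N : ℕ) : ℝ≥0∞) ^ 2 / ENNReal.ofReal ((M N : ℝ) ^ (1 + q)))) atTop
      (𝓝 ((L : ℝ≥0∞) ^ (2 * s + (1 + q)) * β + ENNReal.ofReal (a ^ (-s)) * 0)) :=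
    tendsto_const_nhds.add (ENNReal.Tendsto.const_mul
      ((tendsto_sq_div_rpow (by linarith : 2 < 1 + q)).comp hMtop) (Or.inr ENNReal.ofReal_ne_top))
  have hle := le_of_tendsto_of_tendsto_of_frequently hl hr
    ((hfreq.and_eventually (hpert.and (eventually_gt_atTop 0))).mono ?_)
  · rw [mul_zero, add_zero] at hle
    have hT := ENNReal.div_rpow_le_of_le_mul w (by linarith : 0 ≤ q)
      (pow_ne_zero d hLne) (ENNReal.pow_ne_top ENNReal.coe_ne_top)
      (hvol.trans (by gcongr : _ ≤ (L : ℝ≥0∞) ^ d * normHausdorff d d' A))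
    refine absurd (hT.trans ?_) (not_le.2 hLβ)
    rw [ENNReal.rpow_add _ _ hLne ENNReal.coe_ne_top, mul_assoc, ENNReal.rpow_mul,
      ENNReal.rpow_natCast]
    gcongr
  · rintro N ⟨hN, hNp, hN0⟩
    have hNr : (0 : ℝ) < N := by exact_mod_cast hN0
    have hNp0 : 0 < (N : ℝ) ^ (1 + q) := by positivity
    have hMN : (L : ℝ)⁻¹ * N ≤ M N := Nat.le_ceil _
    have hM0 : (0 : ℝ) < M N := lt_of_lt_of_le (by positivity) hMN
    rw [ENNReal.div_lt_iff (Or.inl (by simpa using hNp0)) (Or.inl ENNReal.ofReal_ne_top)] at hN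
    obtain ⟨ω, hωA, hωN, hω⟩ := exists_rieszEnergy_lt hN
    rw [← ENNReal.ofReal_coe_nnreal, ← ENNReal.ofReal_mul hβ0.le] at hω
    obtain ⟨ω', hω', hcard, f, hfC, hf⟩ := hNp ω hωA hωN hω.le
    have hE := minRieszEnergy_card_le hs0.le (f := G ∘ f) (B := G '' C) (ω := ω')
      (fun x hx => mem_image_of_mem G (hfC x hx)) (mul_pos hLr0 hLr0) ha fun x hx y hy => by
        refine (hG _ (hfC x hx) _ (hfC y hy)).imp_left fun h => (hf x hx y hy).trans ?_
        rw [mul_assoc]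
        exact mul_le_mul_of_nonneg_left h hLr0.le
    have hE' := hE.trans (by gcongr; exact (rieszEnergy_mono s hω').trans hω.le :
      _ ≤ ENNReal.ofReal (((L : ℝ) * L) ^ s) * ENNReal.ofReal (β * (N : ℝ) ^ (1 + q)) +
        ENNReal.ofReal (a ^ (-s)) * (ω'.card : ℝ≥0∞) ^ 2)
    rw [hcard] at hE'
    change minRieszEnergy s (G '' C) (M N) / ENNReal.ofReal ((M N : ℝ) ^ (1 + q)) ≤ _
    refine (ENNReal.div_le_div_right hE' _).trans ?_
    rw [ENNReal.add_div, mul_div_assoc (ENNReal.ofReal (a ^ (-s)))]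
    gcongr
    rw [← ENNReal.ofReal_mul (by positivity), ← ENNReal.ofReal_div_of_pos (by positivity),
      ← ENNReal.ofReal_coe_nnreal, ← ENNReal.ofReal_coe_nnreal (p := β),
      ENNReal.ofReal_rpow_of_pos hLr0, ← ENNReal.ofReal_mul (by positivity)]
    apply ENNReal.ofReal_le_ofReal
    rw [div_le_iff₀ (by positivity)]
    have h1 : (N : ℝ) ^ (1 + q) ≤ (L : ℝ) ^ (1 + q) * (M N : ℝ) ^ (1 + q) := by
      rw [← Real.mul_rpow hLr0.le hM0.le]
      refine Real.rpow_le_rpow hNr.le ?_ (by linarith)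
      rwa [inv_mul_le_iff₀ hLr0] at hMN
    have h2 : ((L : ℝ) * L) ^ s = (L : ℝ) ^ (2 * s) := by
      rw [Real.mul_rpow hLr0.le hLr0.le, ← Real.rpow_add hLr0, two_mul]
    calc ((L : ℝ) * L) ^ s * (β * (N : ℝ) ^ (1 + q))
        ≤ (L : ℝ) ^ (2 * s) * (β * ((L : ℝ) ^ (1 + q) * (M N : ℝ) ^ (1 + q))) := by
          rw [h2]; gcongr
      _ = _ := by rw [Real.rpow_add hLr0 (2 * s)]; ring

/-- for a `d`-rectifiable manifold `A ⊆ ℝ^{d'}` and `s > d`,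
`ℰ_s(A,N)/N^{1+s/d} → C_{s,d}/H_d(A)^{s/d}` in `[0,∞]`, where `C_{s,d} ∈ (0,∞)` is the
constant for which the corresponding limit holds for every compact subset of `ℝ^d`. -/
theorem minRieszEnergy_div_tendsto_of_rectifiableManifold (d d' : ℕ) (hd : 1 ≤ d)
    (hdd : d ≤ d') (s : ℝ) (hs : (d : ℝ) < s)
    (A : Set (EuclideanSpace ℝ (Fin d'))) (hA : IsRectifiableManifold d d' A)
    (C : ℝ) (hC : 0 < C)
    (hCdef : ∀ K : Set (EuclideanSpace ℝ (Fin d)), IsCompact K →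
      Tendsto
        (fun N : ℕ => minRieszEnergy s K N / ENNReal.ofReal ((N : ℝ) ^ (1 + s / (d : ℝ))))
        atTop (𝓝 (ENNReal.ofReal C / (volume K) ^ (s / (d : ℝ))))) :
    Tendsto
      (fun N : ℕ => minRieszEnergy s A N / ENNReal.ofReal ((N : ℝ) ^ (1 + s / (d : ℝ))))
      atTop
      (𝓝 (ENNReal.ofReal C / (normHausdorff d d' A) ^ (s / (d : ℝ)))) :=
  tendsto_order.2 ⟨fun _ hb => hA.eventually_lt_minRieszEnergy_div hd hs hCdef hb,
    fun _ hb => hA.eventually_minRieszEnergy_div_lt hd hs (by simpa using hC) hCdef hb⟩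
end
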